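/- Let g be an indecomposable symmetrizable Kac-Moody algebra, finitely Σ-graded with grading subalgebra m. Then m is symmetrizable, and the restriction to m of the nondegenerate invariant bilinear form of g is nondegenerate. -/

import Mathlib

attribute [local instance] Classical.propDecidable

noncomputable section

namespace KMG

open Module

/-! ### Generalized Cartan matrices -/

/-- `A` is a generalized Cartan matrix. -/
def IsGCM {I : Type*} (A : Matrix I I ℤ) : Prop :=
  (∀ i, A i i = 2) ∧ (∀ i j, i ≠ j → A i j ≤ 0) ∧ ∀ i j, A i j = 0 → A j i = 0

/-- `A` is indecomposable. -/
def Indecomposable {I : Type*} (A : Matrix I I ℤ) : Prop :=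
  ∀ s : Set I, s.Nonempty → sᶜ.Nonempty → ∃ i ∈ s, ∃ j ∈ sᶜ, A i j ≠ 0

/-- `A` is symmetrizable: `D A` is symmetric for an invertible diagonal matrix `D`. -/
def Symmetrizable {I : Type*} (A : Matrix I I ℤ) : Prop :=
  ∃ d : I → ℚ, (∀ i, d i ≠ 0) ∧ ∀ i j, d i * (A i j : ℚ) = d j * (A j i : ℚ)

/-- The principal submatrix of `A` indexed by a subset `S`. -/
def restrictM {I : Type*} (A : Matrix I I ℤ) (S : Set I) : Matrix S S ℤ :=
  fun i j => A i.1 j.1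

/-- `A` is of finite type: `A u > 0` for some `u > 0` (Kac, Thm. 4.3). -/
def IsFiniteType {I : Type*} (A : Matrix I I ℤ) : Prop :=
  ∃ u : I → ℚ, (∀ i, 0 < u i) ∧ ∀ i, 0 < ∑ᶠ j, (A i j : ℚ) * u j

/-- `A` is of affine type: `A` indecomposable and `A u = 0` for some `u > 0`. -/
def IsAffineType {I : Type*} (A : Matrix I I ℤ) : Prop :=
  Indecomposable A ∧ ∃ u : I → ℚ, (∀ i, 0 < u i) ∧ ∀ i, ∑ᶠ j, (A i j : ℚ) * u j = 0

/-- `A` is of indefinite type: `A u < 0` for some `u > 0`. -/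
def IsIndefiniteType {I : Type*} (A : Matrix I I ℤ) : Prop :=
  ∃ u : I → ℚ, (∀ i, 0 < u i) ∧ ∀ i, ∑ᶠ j, (A i j : ℚ) * u j < 0

/-- The corank of a generalized Cartan matrix. -/
def gcmCorank {I : Type*} [Fintype I] [DecidableEq I] (A : Matrix I I ℤ) : ℕ :=
  Fintype.card I - (A.map ((↑) : ℤ → ℚ)).rank

/-- The connected component of the vertex `k` in the subdiagram of the Dynkin diagram of `A`
with vertex set `S`. -/
def cmpnt {I : Type*} (A : Matrix I I ℤ) (S : Set I) (k : I) : Set I :=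
  {i | i ∈ S ∧ Relation.ReflTransGen (fun x y => x ∈ S ∧ y ∈ S ∧ A x y ≠ 0) k i}

/-- `A` is hyperbolic: deleting any one vertex of the Dynkin diagram leaves a disjoint union
of diagrams of finite or affine type. -/
def IsHyperbolic {I : Type*} (A : Matrix I I ℤ) : Prop :=
  ∀ i₀ k : I, k ≠ i₀ →
    IsFiniteType (restrictM A (cmpnt A {i | i ≠ i₀} k)) ∨
      IsAffineType (restrictM A (cmpnt A {i | i ≠ i₀} k))

/-- `A` is Lorentzian: `A` is nonsingular and its symmetrization has signature `(+,...,+,-)`. -/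
def IsLorentzian {I : Type*} [Fintype I] [DecidableEq I] (A : Matrix I I ℤ) : Prop :=
  IsUnit (A.map ((↑) : ℤ → ℚ)).det ∧
    ∃ d : I → ℚ, (∀ i, 0 < d i) ∧ (∀ i j, d i * (A i j : ℚ) = d j * (A j i : ℚ)) ∧
      ∃ P : Matrix I I ℝ, IsUnit P.det ∧ ∃ i₀ : I,
        P.transpose * (Matrix.of fun i j => ((d i : ℝ) * (A i j : ℝ))) * P =
          Matrix.diagonal fun i => if i = i₀ then (-1 : ℝ) else 1

/-! ### Weight spaces -/

variable {g : Type*} [LieRing g] [LieAlgebra ℂ g]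

/-- The weight space of weight `χ` for the adjoint action on `g` of a space `V` mapping to `g`
by `ι`. -/
def wtSpaceι {V : Type*} [AddCommGroup V] [Module ℂ V] (ι : V →ₗ[ℂ] g)
    (χ : Module.Dual ℂ V) : Submodule ℂ g where
  carrier := {x | ∀ v : V, ⁅ι v, x⁆ = χ v • x}
  add_mem' := fun ha hb v => by rw [lie_add, ha v, hb v, smul_add]
  zero_mem' := fun v => by rw [lie_zero, smul_zero]
  smul_mem' := fun c x hx v => by rw [lie_smul, hx v, smul_comm]

/-! ### Kac-Moody algebras -/

/-- A (symmetrizable) Kac-Moody algebra structure on the Lie algebra `g`, for the generalized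
Cartan matrix `A` indexed by `I` : a realization `(H, root, coroot)` of `A` together with
Chevalley generators `e i`, `f i` satisfying the Chevalley-Serre relations, such that `g` is
generated by `H` and the `e i, f i`, is diagonalizable under `H`, with `0`-weight space `H`. -/
structure KacMoodyAlgebra {I : Type*} [Fintype I] [DecidableEq I] (A : Matrix I I ℤ)
    (g : Type*) [LieRing g] [LieAlgebra ℂ g] : Type _ where
  H : Submodule ℂ g
  root : I → Module.Dual ℂ H
  coroot : I → H
  e : I → g
  f : I → g
  findimH : FiniteDimensional ℂ H
  finrankH : Module.finrank ℂ H = Fintype.card I + gcmCorank A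
  indepRoot : LinearIndependent ℂ root
  indepCoroot : LinearIndependent ℂ coroot
  pairing : ∀ i j, root j (coroot i) = (A i j : ℂ)
  abelian : ∀ x y : H, ⁅(x : g), (y : g)⁆ = 0
  lie_e : ∀ (x : H) (i : I), ⁅(x : g), e i⁆ = root i x • e i
  lie_f : ∀ (x : H) (i : I), ⁅(x : g), f i⁆ = -(root i x) • f i
  e_f : ∀ i j, ⁅e i, f j⁆ = if j = i then ((coroot i : g)) else 0
  serre_e : ∀ i j, i ≠ j →
    ((LieAlgebra.ad ℂ g (e i)) ^ (1 - A i j).toNat) (e j) = 0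
  serre_f : ∀ i j, i ≠ j →
    ((LieAlgebra.ad ℂ g (f i)) ^ (1 - A i j).toNat) (f j) = 0
  generates : LieSubalgebra.lieSpan ℂ g ((H : Set g) ∪ Set.range e ∪ Set.range f) = ⊤
  weight_decomp : ⨆ χ : Module.Dual ℂ H, wtSpaceι H.subtype χ = ⊤
  zero_weight : wtSpaceι H.subtype (0 : Module.Dual ℂ H) = H

variable {I : Type*} [Fintype I] [DecidableEq I] {A : Matrix I I ℤ}

/-- The root system of a Kac-Moody algebra: nonzero weights of the adjoint action of the
Cartan subalgebra. -/
def Delta (G : KacMoodyAlgebra A g) : Set (Module.Dual ℂ G.H) :=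
  {χ | χ ≠ 0 ∧ wtSpaceι G.H.subtype χ ≠ ⊥}

/-- The positive roots with respect to the standard root basis. -/
def posRoots (G : KacMoodyAlgebra A g) : Set (Module.Dual ℂ G.H) :=
  {χ ∈ Delta G | ∃ c : I → ℕ, χ = ∑ i, (c i : ℂ) • G.root i}

/-- The real roots : the orbit of the simple roots under the Weyl group. -/
inductive IsRealRoot (G : KacMoodyAlgebra A g) : Module.Dual ℂ G.H → Prop
  | simple (i : I) : IsRealRoot G (G.root i)
  | reflect (i : I) (χ : Module.Dual ℂ G.H) :
      IsRealRoot G χ → IsRealRoot G (χ - χ (G.coroot i) • G.root i)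

/-- The subalgebra `g(S)` generated by the root spaces `g_{± α_i}`, `i ∈ S`. -/
def gS (G : KacMoodyAlgebra A g) (S : Set I) : LieSubalgebra ℂ g :=
  LieSubalgebra.lieSpan ℂ g ({x | ∃ i ∈ S, x = G.e i} ∪ {x | ∃ i ∈ S, x = G.f i})

/-- The subspace `h^J = {h ∈ h | ⟨α_j, h⟩ = 0 ∀ j ∈ J}`. -/
def hJsub (G : KacMoodyAlgebra A g) (J : Set I) : Submodule ℂ G.H :=
  ⨅ j ∈ J, LinearMap.ker (G.root j)

/-- `Hk` is the canonical semisimple element attached to `k` and the component `S = I_k` :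
it lies in the span of the coroots from `S` and satisfies `⟨α_i, H_k⟩ = 2 δ_{i,k}` on `S`. -/
def IsHGen (G : KacMoodyAlgebra A g) (S : Set I) (k : I) (Hk : G.H) : Prop :=
  Hk ∈ Submodule.span ℂ (G.coroot '' S) ∧
    ∀ i ∈ S, G.root i Hk = if i = k then 2 else 0

/-- `g(S)` is `A₁`-graded by the `sl₂`-triple with semisimple element `Hk` :
`ad Hk` has only eigenvalues `0, 2, -2` on `g(S)`. -/
def A1GradedBy (G : KacMoodyAlgebra A g) (S : Set I) (Hk : g) : Prop :=
  ∀ x ∈ gS G S, x ∈ Module.End.eigenspace (LieAlgebra.ad ℂ g Hk) 0 ⊔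
    Module.End.eigenspace (LieAlgebra.ad ℂ g Hk) 2 ⊔
      Module.End.eigenspace (LieAlgebra.ad ℂ g Hk) (-2)

/-- The pair `(I_k, J_k)` (for `I_k` the connected component of `k` in `J ∪ {k}`) is an
irreducible `C`-admissible pair. -/
def CAdmissibleComponent (G : KacMoodyAlgebra A g) (J : Set I) (k : I) : Prop :=
  IsFiniteType (restrictM A (cmpnt A (J ∪ {k}) k)) ∧
    ∃ Hk : G.H, IsHGen G (cmpnt A (J ∪ {k}) k) k Hk ∧
      ∃ E F : g, E ∈ gS G (cmpnt A (J ∪ {k}) k) ∧ F ∈ gS G (cmpnt A (J ∪ {k}) k) ∧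
        IsSl2Triple (Hk : g) E F ∧ A1GradedBy G (cmpnt A (J ∪ {k}) k) (Hk : g)

/-- The data of a `C`-admissible pair `(I, J)` : for each `k ∉ J`, the component `I_k` is of
finite type and carries an `sl₂`-triple `(E_k, H_k, F_k)` which `A₁`-grades `g(I_k)`. -/
structure CAdmissibleData (G : KacMoodyAlgebra A g) (J : Set I) : Type _ where
  finJ : IsFiniteType (restrictM A J)
  Hc : {k : I // k ∉ J} → G.H
  E : {k : I // k ∉ J} → g
  F : {k : I // k ∉ J} → g
  finIk : ∀ k : {k : I // k ∉ J}, IsFiniteType (restrictM A (cmpnt A (J ∪ {k.1}) k.1))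
  isHGen : ∀ k, IsHGen G (cmpnt A (J ∪ {k.1}) k.1) k.1 (Hc k)
  memE : ∀ k, E k ∈ gS G (cmpnt A (J ∪ {k.1}) k.1)
  memF : ∀ k, F k ∈ gS G (cmpnt A (J ∪ {k.1}) k.1)
  sl2 : ∀ k, IsSl2Triple ((Hc k : g)) (E k) (F k)
  a1 : ∀ k, A1GradedBy G (cmpnt A (J ∪ {k.1}) k.1) ((Hc k : g))

/-- `(I,J)` is a `C`-admissible pair. -/
def CAdmissiblePair (G : KacMoodyAlgebra A g) (J : Set I) : Prop :=
  Nonempty (CAdmissibleData G J)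

/-- The data of a `C`-admissible pair `(Itot, J)` for a subdiagram `Itot ⊆ I`. -/
structure CAdmissibleDataIn (G : KacMoodyAlgebra A g) (Itot J : Set I) : Type _ where
  subJ : J ⊆ Itot
  finJ : IsFiniteType (restrictM A J)
  Hc : {k : I // k ∈ Itot ∧ k ∉ J} → G.H
  E : {k : I // k ∈ Itot ∧ k ∉ J} → g
  F : {k : I // k ∈ Itot ∧ k ∉ J} → g
  finIk : ∀ k : {k : I // k ∈ Itot ∧ k ∉ J},
    IsFiniteType (restrictM A (cmpnt A (J ∪ {k.1}) k.1))
  isHGen : ∀ k, IsHGen G (cmpnt A (J ∪ {k.1}) k.1) k.1 (Hc k)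
  memE : ∀ k, E k ∈ gS G (cmpnt A (J ∪ {k.1}) k.1)
  memF : ∀ k, F k ∈ gS G (cmpnt A (J ∪ {k.1}) k.1)
  sl2 : ∀ k, IsSl2Triple ((Hc k : g)) (E k) (F k)
  a1 : ∀ k, A1GradedBy G (cmpnt A (J ∪ {k.1}) k.1) ((Hc k : g))

/-- The `C`-admissible subalgebra `g^J` : generated by `h^J` and the `E_k, F_k`. -/
def CAdmissibleData.gJ {G : KacMoodyAlgebra A g} {J : Set I} (D : CAdmissibleData G J) :
    LieSubalgebra ℂ g :=
  LieSubalgebra.lieSpan ℂ g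
    ((((hJsub G J).map G.H.subtype : Submodule ℂ g) : Set g) ∪ Set.range D.E ∪ Set.range D.F)

/-- `GJ` is "the" Kac-Moody structure on `g^J` associated to a `C`-admissible pair: its
Cartan subalgebra is `h^J`, its coroots are the `H_k` and its Chevalley generators are the
`E_k, F_k`; the matrix `A'` is `A^J`, i.e. `a'_{k,l} = ⟨α_l, H_k⟩`. -/
def CAdmissibleData.IsAssocKM {G : KacMoodyAlgebra A g} {J : Set I} (D : CAdmissibleData G J)
    {A' : Matrix {k : I // k ∉ J} {k : I // k ∉ J} ℤ}
    (GJ : KacMoodyAlgebra A' ↥D.gJ) : Prop :=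
  (∀ k l, (A' k l : ℂ) = G.root l.1 (D.Hc k)) ∧
  GJ.H.map D.gJ.toSubmodule.subtype = (hJsub G J).map G.H.subtype ∧
  (∀ k, ((GJ.coroot k : ↥D.gJ) : g) = ((D.Hc k : ↥G.H) : g)) ∧
  (∀ k, ((GJ.e k : ↥D.gJ) : g) = D.E k) ∧ (∀ k, ((GJ.f k : ↥D.gJ) : g) = D.F k)

/-! ### Finite gradations -/

/-- `g` is finitely `Σ`-graded, where `Σ` is the root system of the Kac-Moody algebra `m`
(with Kac-Moody structure `M`) and `m` is embedded in `g` by `φ` (the grading subalgebra is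
the image of `φ`): `g` is the sum of the weight spaces `V_γ`, `γ ∈ Σ ∪ {0}`, of the adjoint
action of the Cartan subalgebra of `m`, and each `V_γ` is finite dimensional. -/
def IsFinGrading {S : Type*} [Fintype S] [DecidableEq S] {B : Matrix S S ℤ}
    {m : Type*} [LieRing m] [LieAlgebra ℂ m] (M : KacMoodyAlgebra B m)
    (φ : m →ₗ⁅ℂ⁆ g) : Prop :=
  Function.Injective φ ∧
  (⨆ χ ∈ insert (0 : Module.Dual ℂ M.H) (Delta M),
      wtSpaceι (φ.toLinearMap ∘ₗ M.H.subtype) χ) = ⊤ ∧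
  ∀ χ ∈ insert (0 : Module.Dual ℂ M.H) (Delta M),
      FiniteDimensional ℂ (wtSpaceι (φ.toLinearMap ∘ₗ M.H.subtype) χ)

section Grading

variable {S : Type*} [Fintype S] [DecidableEq S] {B : Matrix S S ℤ}
variable {m : Type*} [LieRing m] [LieAlgebra ℂ m]

/-- The inclusion of the Cartan subalgebra of the grading subalgebra into the Cartan
subalgebra of `g` (given `a ⊆ h`). -/
def cartanIncl (G : KacMoodyAlgebra A g) (M : KacMoodyAlgebra B m) (φ : m →ₗ⁅ℂ⁆ g)
    (hle : M.H.map φ.toLinearMap ≤ G.H) : M.H →ₗ[ℂ] G.H :=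
  LinearMap.codRestrict G.H (φ.toLinearMap ∘ₗ M.H.subtype)
    (fun x => hle (Submodule.mem_map_of_mem x.2))

/-- The restriction `ρ_a(χ)` to the Cartan subalgebra `a` of `m` of a linear form `χ` on `h`. -/
def resD (G : KacMoodyAlgebra A g) (M : KacMoodyAlgebra B m) (φ : m →ₗ⁅ℂ⁆ g)
    (hle : M.H.map φ.toLinearMap ≤ G.H) (χ : Module.Dual ℂ G.H) : Module.Dual ℂ M.H :=
  χ.comp (cartanIncl G M φ hle)

/-- The restriction `ρ_a(α_i)` of the simple root `α_i` to `a`. -/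
def resRoot (G : KacMoodyAlgebra A g) (M : KacMoodyAlgebra B m) (φ : m →ₗ⁅ℂ⁆ g)
    (hle : M.H.map φ.toLinearMap ≤ G.H) (i : I) : Module.Dual ℂ M.H :=
  resD G M φ hle (G.root i)

/-- The root basis of `M` is adapted to the root basis of `G` :
`ρ_a(Δ⁺) ⊆ Σ⁺ ∪ {0}`. -/
def Adapted (G : KacMoodyAlgebra A g) (M : KacMoodyAlgebra B m) (φ : m →ₗ⁅ℂ⁆ g)
    (hle : M.H.map φ.toLinearMap ≤ G.H) : Prop :=
  ∀ χ ∈ posRoots G, resD G M φ hle χ = 0 ∨ resD G M φ hle χ ∈ posRoots M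

/-- The set `J = {i ∈ I | ρ_a(α_i) = 0}`. -/
def Jof (G : KacMoodyAlgebra A g) (M : KacMoodyAlgebra B m) (φ : m →ₗ⁅ℂ⁆ g)
    (hle : M.H.map φ.toLinearMap ≤ G.H) : Set I :=
  {i | resRoot G M φ hle i = 0}

/-- The set `Γ_s = {i ∈ I' | ρ_a(α_i) = γ_s}`. -/
def GammaOf (G : KacMoodyAlgebra A g) (M : KacMoodyAlgebra B m) (φ : m →ₗ⁅ℂ⁆ g)
    (hle : M.H.map φ.toLinearMap ≤ G.H) (s : S) : Set I :=
  {i | resRoot G M φ hle i = M.root s}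

/-- The set `I'_re = {i ∈ I' | ρ_a(α_i) ∈ Π_a}`. -/
def IpRe (G : KacMoodyAlgebra A g) (M : KacMoodyAlgebra B m) (φ : m →ₗ⁅ℂ⁆ g)
    (hle : M.H.map φ.toLinearMap ≤ G.H) : Set I :=
  {i | ∃ s : S, resRoot G M φ hle i = M.root s}

/-- The set `I'_im = {i ∈ I | ρ_a(α_i) ∉ Π_a ∪ {0}}`. -/
def IpIm (G : KacMoodyAlgebra A g) (M : KacMoodyAlgebra B m) (φ : m →ₗ⁅ℂ⁆ g)
    (hle : M.H.map φ.toLinearMap ≤ G.H) : Set I :=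
  {i | resRoot G M φ hle i ≠ 0 ∧ ∀ s : S, resRoot G M φ hle i ≠ M.root s}

/-- The set `I_re` : union of the components `I_k`, `k ∈ I'_re`. -/
def IreOf (G : KacMoodyAlgebra A g) (M : KacMoodyAlgebra B m) (φ : m →ₗ⁅ℂ⁆ g)
    (hle : M.H.map φ.toLinearMap ≤ G.H) : Set I :=
  {i | ∃ k ∈ IpRe G M φ hle, i ∈ cmpnt A (Jof G M φ hle ∪ {k}) k}

/-- `g` is maximally finitely graded: finitely graded, with `a ⊆ h`, the root basis of the
grading subalgebra adapted, and the corresponding sets `J` and `I'_im` empty. -/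
def MaxFinGrading (G : KacMoodyAlgebra A g) (M : KacMoodyAlgebra B m) (φ : m →ₗ⁅ℂ⁆ g) : Prop :=
  IsFinGrading M φ ∧ ∃ hle : M.H.map φ.toLinearMap ≤ G.H,
    Adapted G M φ hle ∧ Jof G M φ hle = ∅ ∧ IpIm G M φ hle = ∅

end Grading

/-- `(π, πv)` is a root basis (with generalized Cartan matrix `B`) of the root system `Rts`. -/
def IsRootBasis {V : Type*} [AddCommGroup V] [Module ℂ V] {S : Type*} [Fintype S]
    (B : Matrix S S ℤ) (Rts : Set (Module.Dual ℂ V)) (π : S → Module.Dual ℂ V)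
    (πv : S → V) : Prop :=
  LinearIndependent ℂ π ∧ LinearIndependent ℂ πv ∧
  (∀ s t, π t (πv s) = (B s t : ℂ)) ∧ (∀ s, π s ∈ Rts) ∧
  ∀ χ ∈ Rts, (∃ c : S → ℕ, χ = ∑ s, (c s : ℂ) • π s) ∨
    (∃ c : S → ℕ, χ = -∑ s, (c s : ℂ) • π s)

/-- `Bf` is a nondegenerate invariant symmetric bilinear form on `g`. -/
def InvariantForm (Bf : g →ₗ[ℂ] g →ₗ[ℂ] ℂ) : Prop :=
  (∀ x y, Bf x y = Bf y x) ∧ (∀ x y z, Bf ⁅x, y⁆ z = Bf x ⁅y, z⁆) ∧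
  ∀ x, (∀ y, Bf x y = 0) → x = 0

/-- `Bf` is "the" invariant bilinear form of the Kac-Moody algebra `G` : nondegenerate,
invariant, symmetric, with `(α_i∨, α_i∨)` a positive rational for all `i`. -/
def NormalizedInvForm (G : KacMoodyAlgebra A g) (Bf : g →ₗ[ℂ] g →ₗ[ℂ] ℂ) : Prop :=
  InvariantForm Bf ∧ ∀ i : I, ∃ q : ℚ, 0 < q ∧ Bf ((G.coroot i : g)) ((G.coroot i : g)) = (q : ℂ)

/-- `(e', f')` is a system of Chevalley generators for `G` (with the given Cartan subalgebra,
simple roots and coroots). -/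
def IsChevalleyGens (G : KacMoodyAlgebra A g) (e' f' : I → g) : Prop :=
  (∀ (x : G.H) (i : I), ⁅(x : g), e' i⁆ = G.root i x • e' i) ∧
  (∀ (x : G.H) (i : I), ⁅(x : g), f' i⁆ = -(G.root i x) • f' i) ∧
  (∀ i j, ⁅e' i, f' j⁆ = if j = i then ((G.coroot i : g)) else 0) ∧
  (∀ i j, i ≠ j → ((LieAlgebra.ad ℂ g (e' i)) ^ (1 - A i j).toNat) (e' j) = 0) ∧
  (∀ i j, i ≠ j → ((LieAlgebra.ad ℂ g (f' i)) ^ (1 - A i j).toNat) (f' j) = 0) ∧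
  LieSubalgebra.lieSpan ℂ g ((G.H : Set g) ∪ Set.range e' ∪ Set.range f') = ⊤


/-- The subalgebra `g(I_re)` of `g` generated by `h_{I_re}` and the `e_i, f_i`, `i ∈ I_re`. -/
def gIre (G : KacMoodyAlgebra A g) (Ire : Set I) (hIre : Submodule ℂ g) : LieSubalgebra ℂ g :=
  LieSubalgebra.lieSpan ℂ g
    ((hIre : Set g) ∪ {x | ∃ i ∈ Ire, x = G.e i} ∪ {x | ∃ i ∈ Ire, x = G.f i})

/-- `GI` is "the" Kac-Moody structure on `g(I_re)` : its Cartan subalgebra is `h_{I_re}`,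
its coroots and Chevalley generators are the `α_i∨, e_i, f_i` of `g`, for `i ∈ I_re`. -/
def IsAssocKMIre (G : KacMoodyAlgebra A g) (Ire : Set I) (hIre : Submodule ℂ g)
    {A'' : Matrix ↥Ire ↥Ire ℤ} (GI : KacMoodyAlgebra A'' ↥(gIre G Ire hIre)) : Prop :=
  GI.H.map (gIre G Ire hIre).toSubmodule.subtype = hIre ∧
  (∀ i, ((GI.coroot i : ↥(gIre G Ire hIre)) : g) = ((G.coroot i.1 : ↥G.H) : g)) ∧
  (∀ i, ((GI.e i : ↥(gIre G Ire hIre)) : g) = G.e i.1) ∧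
  (∀ i, ((GI.f i : ↥(gIre G Ire hIre)) : g) = G.f i.1)

/-! ### Admissible quotients and maximal gradations -/

/-- `ρ : I → S` is an admissible quotient map for `A` : fibers are totally disconnected (MG1)
and the column sums over a fiber are constant along fibers (MG2). -/
def AdmissibleQuotient {I S : Type*} (A : Matrix I I ℤ) (ρ : I → S) : Prop :=
  Function.Surjective ρ ∧
  (∀ k l, k ≠ l → ρ k = ρ l → A k l = 0) ∧
  ∀ s t : S, s ≠ t → ∀ j j', ρ j = t → ρ j' = t →
    ∑ᶠ i ∈ {i | ρ i = s}, A i j = ∑ᶠ i ∈ {i | ρ i = s}, A i j'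

section Quotient

variable {S : Type*} [Fintype S] [DecidableEq S]

/-- `γ_s∨ = ∑_{k ∈ Γ_s} α_k∨`. -/
def gammaV (G : KacMoodyAlgebra A g) (ρ : I → S) (s : S) : G.H :=
  ∑ᶠ k ∈ {k | ρ k = s}, G.coroot k

/-- `X̄_s = ∑_{k ∈ Γ_s} e_k`. -/
def Xbar (G : KacMoodyAlgebra A g) (ρ : I → S) (s : S) : g :=
  ∑ᶠ k ∈ {k | ρ k = s}, G.e k

/-- `Ȳ_s = ∑_{k ∈ Γ_s} f_k`. -/
def Ybar (G : KacMoodyAlgebra A g) (ρ : I → S) (s : S) : g :=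
  ∑ᶠ k ∈ {k | ρ k = s}, G.f k

/-- The subalgebra `g^ρ` generated by `a` and the `X̄_s, Ȳ_s`. -/
def gRho (G : KacMoodyAlgebra A g) (ρ : I → S) (a : Submodule ℂ G.H) : LieSubalgebra ℂ g :=
  LieSubalgebra.lieSpan ℂ g
    (((a.map G.H.subtype : Submodule ℂ g) : Set g) ∪ Set.range (Xbar G ρ) ∪
      Set.range (Ybar G ρ))

/-- `Gρ` is "the" Kac-Moody structure on `g^ρ` : its Cartan subalgebra is `a`, its coroots
are the `γ_s∨` and its Chevalley generators are the `X̄_s, Ȳ_s`. -/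
def IsAssocKMrho (G : KacMoodyAlgebra A g) (ρ : I → S) (a : Submodule ℂ G.H)
    {Abar : Matrix S S ℤ} (Gρ : KacMoodyAlgebra Abar ↥(gRho G ρ a)) : Prop :=
  Gρ.H.map (gRho G ρ a).toSubmodule.subtype = a.map G.H.subtype ∧
  (∀ s, ((Gρ.coroot s : ↥(gRho G ρ a)) : g) = ((gammaV G ρ s : ↥G.H) : g)) ∧
  (∀ s, ((Gρ.e s : ↥(gRho G ρ a)) : g) = Xbar G ρ s) ∧
  (∀ s, ((Gρ.f s : ↥(gRho G ρ a)) : g) = Ybar G ρ s)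

end Quotient

end KMG


open KMG

namespace KMG

section WeightSpaces

variable {g : Type*} [LieRing g] [LieAlgebra ℂ g] {V : Type*} [AddCommGroup V] [Module ℂ V]
  {ι : V →ₗ[ℂ] g}

theorem lie_mem_wtSpace {χ ψ : Module.Dual ℂ V} {x y : g} (hx : x ∈ wtSpaceι ι χ)
    (hy : y ∈ wtSpaceι ι ψ) : ⁅x, y⁆ ∈ wtSpaceι ι (χ + ψ) := by
  intro v
  rw [leibniz_lie, hx v, hy v, smul_lie, lie_smul, LinearMap.add_apply, add_smul]

/-- The weight components of an element of an `ι`-stable subspace lie in that subspace. -/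
theorem mem_of_sum_wtSpace_mem {N : Submodule ℂ g} (hN : ∀ v, ∀ x ∈ N, ⁅ι v, x⁆ ∈ N)
    (s : Finset (Module.Dual ℂ V)) : ∀ x : Module.Dual ℂ V → g,
    (∀ χ ∈ s, x χ ∈ wtSpaceι ι χ) → ∑ χ ∈ s, x χ ∈ N → ∀ χ ∈ s, x χ ∈ N := by
  induction s using Finset.induction_on with
  | empty => simp
  | insert ψ s hψ ih =>
    intro x hx hsum
    rw [Finset.sum_insert hψ] at hsum
    have key : ∀ χ ∈ s, x χ ∈ N := by
      intro χ hχ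
      have hne : χ ≠ ψ := fun h => hψ (h ▸ hχ)
      obtain ⟨v, hv⟩ : ∃ v, χ v ≠ ψ v := by
        by_contra! h
        exact hne (LinearMap.ext h)
      have h1 := ih (fun θ => (θ v - ψ v) • x θ)
        (fun θ hθ => Submodule.smul_mem _ _ (hx θ (Finset.mem_insert_of_mem hθ))) (by
          have h2 : ⁅ι v, x ψ + ∑ θ ∈ s, x θ⁆ - ψ v • (x ψ + ∑ θ ∈ s, x θ) ∈ N :=
            N.sub_mem (hN v _ hsum) (N.smul_mem _ hsum)
          convert h2 using 1
          rw [lie_add, hx ψ (Finset.mem_insert_self _ _) v, smul_add, add_sub_add_left_eq_sub,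
            lie_sum, Finset.smul_sum, ← Finset.sum_sub_distrib]
          refine Finset.sum_congr rfl fun θ hθ => ?_
          rw [hx θ (Finset.mem_insert_of_mem hθ) v, sub_smul]) χ hχ
      exact (N.smul_mem_iff (sub_ne_zero.2 hv)).1 h1
    intro χ hχ
    rcases Finset.mem_insert.1 hχ with rfl | h
    · have := N.sub_mem hsum (N.sum_mem key)
      rwa [add_sub_cancel_right] at this
    · exact key χ h

theorem exists_wtSpace_decomp (h : ⨆ χ : Module.Dual ℂ V, wtSpaceι ι χ = ⊤) (x : g) :
    ∃ f : Module.Dual ℂ V →₀ g, (∀ χ, f χ ∈ wtSpaceι ι χ) ∧ (f.sum fun _ y => y) = x ∧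
      ∀ N : Submodule ℂ g, (∀ v, ∀ x ∈ N, ⁅ι v, x⁆ ∈ N) → x ∈ N → ∀ χ, f χ ∈ N := by
  have hx : x ∈ ⨆ χ : Module.Dual ℂ V, wtSpaceι ι χ := h ▸ Submodule.mem_top
  obtain ⟨f, hf, hs⟩ := (Submodule.mem_iSup_iff_exists_finsupp _ _).1 hx
  refine ⟨f, hf, hs, fun N hN hxN χ => ?_⟩
  by_cases hχ : χ ∈ f.support
  · exact mem_of_sum_wtSpace_mem hN f.support f (fun χ _ => hf χ) (by rw [← hs] at hxN; exact hxN)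
      χ hχ
  · rw [Finsupp.notMem_support_iff.1 hχ]
    exact N.zero_mem

/-- A family of subspaces of the weight spaces which spans everything consists of the full
weight spaces. -/
theorem eq_wtSpace_of_le {R : Module.Dual ℂ V → Submodule ℂ g} (hR : ∀ χ, R χ ≤ wtSpaceι ι χ)
    (h : ⨆ χ, R χ = ⊤) (χ : Module.Dual ℂ V) : R χ = wtSpaceι ι χ := by
  refine le_antisymm (hR χ) fun x hx => ?_
  have hxt : x ∈ ⨆ χ, R χ := h ▸ Submodule.mem_top
  obtain ⟨f, hf, hs⟩ := (Submodule.mem_iSup_iff_exists_finsupp _ _).1 hxt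
  have hsum : ∑ θ ∈ insert χ f.support, (f θ - if θ = χ then x else 0) ∈ (⊥ : Submodule ℂ g) := by
    rw [Submodule.mem_bot, Finset.sum_sub_distrib, Finset.sum_ite_eq',
      if_pos (Finset.mem_insert_self _ _), sub_eq_zero, ← hs, Finsupp.sum]
    refine (Finset.sum_subset (Finset.subset_insert _ _) fun θ _ hθ => ?_).symm
    exact Finsupp.notMem_support_iff.1 hθ
  have := mem_of_sum_wtSpace_mem (ι := ι) (N := ⊥) (by simp) (insert χ f.support)
    (fun θ => f θ - if θ = χ then x else 0) (fun θ _ => by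
      split_ifs with hθ
      · exact Submodule.sub_mem _ (hR _ (hf θ)) (hθ ▸ hx)
      · exact Submodule.sub_mem _ (hR _ (hf θ)) (Submodule.zero_mem _)) hsum χ
      (Finset.mem_insert_self _ _)
  rw [if_pos rfl, Submodule.mem_bot, sub_eq_zero] at this
  exact this ▸ hf χ

theorem mem_of_iSup_wtSpace_eq_top {T : Set (Module.Dual ℂ V)}
    (h : ⨆ χ ∈ T, wtSpaceι ι χ = ⊤) {χ : Module.Dual ℂ V} (hχ : wtSpaceι ι χ ≠ ⊥) : χ ∈ T := by
  by_contra hn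
  refine hχ ?_
  rw [← eq_wtSpace_of_le (ι := ι) (R := fun χ => ⨆ _ : χ ∈ T, wtSpaceι ι χ)
    (fun χ => iSup_le fun _ => le_rfl) h χ]
  simp [hn]

/-- Only finitely many weight spaces meet a finite dimensional subspace. -/
theorem finite_wtSpace_le {U : Submodule ℂ g} [FiniteDimensional ℂ U]
    {T : Set (Module.Dual ℂ V)} (hT : ∀ χ ∈ T, wtSpaceι ι χ ≠ ⊥ ∧ wtSpaceι ι χ ≤ U) :
    T.Finite := by
  have hx : ∀ χ : T, ∃ x : U, (x : g) ∈ wtSpaceι ι χ.1 ∧ x ≠ 0 := by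
    intro χ
    obtain ⟨x, hx, h0⟩ := (Submodule.ne_bot_iff _).1 (hT χ.1 χ.2).1
    exact ⟨⟨x, (hT χ.1 χ.2).2 hx⟩, hx, fun h => h0 (congrArg Subtype.val h)⟩
  choose x hx h0 using hx
  have hli : LinearIndependent ℂ x := by
    rw [linearIndependent_iff']
    intro s c hc χ hχ
    have h1 : ∑ θ ∈ s.map (Function.Embedding.subtype _),
        (if h : θ ∈ T then c ⟨θ, h⟩ • (x ⟨θ, h⟩ : g) else 0) ∈ (⊥ : Submodule ℂ g) := by
      rw [Submodule.mem_bot, Finset.sum_map]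
      have := congrArg (Subtype.val : U → g) hc
      simpa using this
    have h2 := mem_of_sum_wtSpace_mem (ι := ι) (N := ⊥) (by simp) _ _ (fun θ hθ => by
      obtain ⟨a, -, rfl⟩ := Finset.mem_map.1 hθ
      simpa using Submodule.smul_mem _ (c a) (hx a)) h1 χ.1
      (Finset.mem_map.2 ⟨χ, hχ, rfl⟩)
    have h3 : c χ • (x χ : g) = 0 := by simpa using h2
    exact (smul_eq_zero.1 h3).resolve_right fun h => h0 χ (Subtype.ext h)
  have : Finite T := hli.finite
  exact Set.toFinite T

theorem form_eq_zero_of_wtSpace {b : g →ₗ[ℂ] g →ₗ[ℂ] ℂ}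
    (hb : ∀ x y z, b ⁅x, y⁆ z = b x ⁅y, z⁆) {χ ψ : Module.Dual ℂ V} {x y : g}
    (hx : x ∈ wtSpaceι ι χ) (hy : y ∈ wtSpaceι ι ψ) (hne : χ + ψ ≠ 0) : b x y = 0 := by
  obtain ⟨v, hv⟩ : ∃ v, (χ + ψ) v ≠ 0 := by
    by_contra! h
    exact hne (LinearMap.ext h)
  have h1 := hb x (ι v) y
  rw [← lie_skew, hx v, hy v] at h1
  simp only [map_neg, map_smul, LinearMap.neg_apply, LinearMap.smul_apply, smul_eq_mul] at h1
  have h2 : (χ + ψ) v * b x y = 0 := by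
    rw [LinearMap.add_apply]
    linear_combination -h1
  exact (mul_eq_zero.1 h2).resolve_left hv

end WeightSpaces

end KMG

namespace KMG

section Triangular

variable {g : Type*} [LieRing g] [LieAlgebra ℂ g]
variable {I : Type*} [Fintype I] [DecidableEq I] {A : Matrix I I ℤ}

/-- The Kac-Moody structure obtained by exchanging the roles of the `e i` and the `f i`. -/
def KacMoodyAlgebra.opp (G : KacMoodyAlgebra A g) : KacMoodyAlgebra A g where
  H := G.H
  root i := -G.root i
  coroot i := -G.coroot i
  e := G.f
  f := G.e
  findimH := G.findimH
  finrankH := G.finrankH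
  indepRoot := by simpa [Pi.neg_def] using G.indepRoot.neg
  indepCoroot := by simpa [Pi.neg_def] using G.indepCoroot.neg
  pairing i j := by simp [G.pairing]
  abelian := G.abelian
  lie_e x i := by rw [G.lie_f, LinearMap.neg_apply]
  lie_f x i := by rw [G.lie_e, LinearMap.neg_apply, neg_neg]
  e_f i j := by
    rw [← lie_skew, G.e_f]
    by_cases h : i = j
    · subst h; simp
    · simp [h, Ne.symm h]
  serre_e := G.serre_f
  serre_f := G.serre_e
  generates := by
    have h := G.generates
    rwa [Set.union_right_comm] at h
  weight_decomp := G.weight_decomp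
  zero_weight := G.zero_weight

/-- `x` is an iterated bracket of elements `e i`, the multiplicities of which are given
by `c`. -/
inductive IsWord (e : I → g) : (I → ℤ) → g → Prop
  | gen (i : I) : IsWord e (Pi.single i 1) (e i)
  | lie (i : I) (c : I → ℤ) (x : g) : IsWord e c x → IsWord e (c + Pi.single i 1) ⁅e i, x⁆

theorem IsWord.nonneg {e : I → g} {c : I → ℤ} {x : g} (h : IsWord e c x) (i : I) : 0 ≤ c i := by
  induction h with
  | gen j => by_cases hij : i = j <;> simp [hij]
  | lie j c x _ ih =>
    by_cases hij : i = j
    · subst hij; simp; omega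
    · simp [hij, ih]

theorem IsWord.one_le_sum {e : I → g} {c : I → ℤ} {x : g} (h : IsWord e c x) :
    1 ≤ ∑ i, c i := by
  induction h with
  | gen j => simp
  | lie j c x _ ih => simp [Finset.sum_add_distrib]; omega

namespace KacMoodyAlgebra

variable (G : KacMoodyAlgebra A g)

/-- The weight with coordinates `c` in the basis of simple roots. -/
def wt (c : I → ℤ) : Module.Dual ℂ G.H := ∑ i, (c i : ℂ) • G.root i

/-- The weight spaces of `g`. -/
abbrev wtSp (χ : Module.Dual ℂ G.H) : Submodule ℂ g := wtSpaceι G.H.subtype χ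

/-- The elements of a standard spanning set of `g`: iterated brackets of the `e i`, elements of
`H`, and iterated brackets of the `f i`. -/
inductive IsTri : (I → ℤ) → g → Prop
  | pos (c : I → ℤ) (x : g) : IsWord G.e c x → IsTri c x
  | car (x : G.H) : IsTri 0 x
  | neg (c : I → ℤ) (x : g) : IsWord G.f c x → IsTri (-c) x

theorem wt_add (c d : I → ℤ) : G.wt (c + d) = G.wt c + G.wt d := by
  simp [wt, add_smul, Finset.sum_add_distrib]

theorem wt_neg (c : I → ℤ) : G.wt (-c) = -G.wt c := by
  simp [wt]

theorem wt_zero : G.wt 0 = 0 := by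
  simp [wt]

theorem wt_single (i : I) : G.wt (Pi.single i 1) = G.root i := by
  simp [wt, Pi.single_apply]

theorem wt_zsmul (n : ℤ) (c : I → ℤ) : G.wt (n • c) = (n : ℂ) • G.wt c := by
  simp [wt, mul_smul, Finset.smul_sum]

theorem wt_opp (c : I → ℤ) : G.opp.wt c = G.wt (-c) := by
  rw [wt_neg]
  change ∑ i, (c i : ℂ) • -G.root i = -∑ i, (c i : ℂ) • G.root i
  rw [← Finset.sum_neg_distrib]
  exact Finset.sum_congr rfl fun i _ => smul_neg _ _

theorem wt_coroot (c : I → ℤ) (i : I) : G.wt c (G.coroot i) = ((∑ j, A i j * c j : ℤ) : ℂ) := by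
  simp [wt, LinearMap.sum_apply, G.pairing, mul_comm]

theorem wt_injective : Function.Injective G.wt := by
  intro c d h
  have h1 : ∑ i, ((c i : ℂ) - d i) • G.root i = 0 := by
    simp only [sub_smul, Finset.sum_sub_distrib]
    exact sub_eq_zero.2 h
  ext i
  have := Fintype.linearIndependent_iff.1 G.indepRoot _ h1 i
  exact_mod_cast sub_eq_zero.1 this

theorem e_mem_wtSp (i : I) : G.e i ∈ G.wtSp (G.root i) := fun x => G.lie_e x i

theorem f_mem_wtSp (i : I) : G.f i ∈ G.wtSp (-G.root i) := fun x => G.lie_f x i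

theorem coe_mem_wtSp (x : G.H) : (x : g) ∈ G.wtSp 0 := fun y => by
  rw [LinearMap.zero_apply, zero_smul]
  exact G.abelian y x

theorem mem_wtSp_zero {x : g} : x ∈ G.wtSp 0 ↔ x ∈ G.H := by
  rw [wtSp, G.zero_weight]

variable {G} in
theorem isWord_mem_wtSp {c : I → ℤ} {x : g} (h : IsWord G.e c x) : x ∈ G.wtSp (G.wt c) := by
  induction h with
  | gen i => rw [wt_single]; exact G.e_mem_wtSp i
  | lie i c x _ ih =>
    rw [wt_add, wt_single, add_comm]
    exact lie_mem_wtSpace (G.e_mem_wtSp i) ih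

variable {G} in
theorem IsTri.mem_wtSp {c : I → ℤ} {x : g} (h : G.IsTri c x) : x ∈ G.wtSp (G.wt c) := by
  cases h with
  | pos c x h => exact isWord_mem_wtSp h
  | car x => rw [wt_zero]; exact G.coe_mem_wtSp x
  | neg c x h =>
    have := isWord_mem_wtSp (G := G.opp) h
    rwa [wt_opp] at this

/-- The span of the standard spanning set. -/
def triSpan : Submodule ℂ g := Submodule.span ℂ {x | ∃ c, G.IsTri c x}

theorem triSpan_opp : G.opp.triSpan = G.triSpan := by
  have key : ∀ G' : KacMoodyAlgebra A g, ∀ x, (∃ c, G'.IsTri c x) → ∃ c, G'.opp.IsTri c x := by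
    rintro G' x ⟨c, h⟩
    cases h with
    | pos c x h => exact ⟨-c, IsTri.neg c x h⟩
    | car x => exact ⟨0, IsTri.car (G := G'.opp) x⟩
    | neg c x h => exact ⟨c, IsTri.pos c x h⟩
  have key' : ∀ x, (∃ c, G.opp.IsTri c x) → ∃ c, G.IsTri c x := by
    rintro x ⟨c, h⟩
    cases h with
    | pos c x h => exact ⟨-c, IsTri.neg c x h⟩
    | car x => exact ⟨0, IsTri.car (G := G) x⟩
    | neg c x h => exact ⟨c, IsTri.pos c x h⟩
  unfold triSpan
  congr 1
  ext x
  exact ⟨key' x, key G x⟩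

variable {G} in
theorem IsTri.mem_triSpan {c : I → ℤ} {x : g} (h : G.IsTri c x) : x ∈ G.triSpan :=
  Submodule.subset_span ⟨c, h⟩

/-- The brackets of `e i` with the iterated brackets of the `f j`. -/
theorem lie_e_isWord_f (i : I) {c : I → ℤ} {x : g} (h : IsWord G.f c x) :
    ⁅G.e i, x⁆ ∈ G.H ⊔ Submodule.span ℂ {y | ∃ d, IsWord G.f d y} := by
  induction h with
  | gen j =>
    rw [G.e_f]
    split_ifs
    · exact Submodule.mem_sup_left (G.coroot i).2
    · exact Submodule.zero_mem _
  | lie j c x hx ih =>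
    rw [leibniz_lie]
    refine Submodule.add_mem _ ?_ ?_
    · rw [G.e_f]
      split_ifs with hji
      · have h1 : IsWord G.opp.e c x := hx
        have := isWord_mem_wtSp h1 (G.coroot i)
        change ⁅(G.coroot i : g), x⁆ = _ at this
        rw [this]
        exact Submodule.mem_sup_right (Submodule.smul_mem _ _ (Submodule.subset_span ⟨c, hx⟩))
      · simp
    · obtain ⟨y, hy, z, hz, hyz⟩ := Submodule.mem_sup.1 ih
      rw [← hyz, lie_add]
      refine Submodule.mem_sup_right (Submodule.add_mem _ ?_ ?_)
      · rw [← lie_skew, G.lie_f ⟨y, hy⟩ j, neg_smul, neg_neg]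
        exact Submodule.smul_mem _ _ (Submodule.subset_span ⟨_, IsWord.gen j⟩)
      · clear hyz
        induction hz using Submodule.span_induction with
        | mem z hz =>
          obtain ⟨d, hd⟩ := hz
          exact Submodule.subset_span ⟨_, IsWord.lie j d z hd⟩
        | zero => simp
        | add a b _ _ ha hb => rw [lie_add]; exact Submodule.add_mem _ ha hb
        | smul t a _ ha => rw [lie_smul]; exact Submodule.smul_mem _ _ ha

theorem lie_e_mem_triSpan (i : I) {x : g} (hx : x ∈ G.triSpan) : ⁅G.e i, x⁆ ∈ G.triSpan := by
  induction hx using Submodule.span_induction with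
  | mem x hx =>
    obtain ⟨c, h⟩ := hx
    cases h with
    | pos c x h => exact (IsTri.pos _ _ (h.lie i)).mem_triSpan
    | car x =>
      rw [← lie_skew, G.lie_e, ← neg_smul]
      exact Submodule.smul_mem _ _ (IsTri.pos _ _ (IsWord.gen i)).mem_triSpan
    | neg c x h =>
      refine (sup_le ?_ ?_ : _ ≤ G.triSpan) (G.lie_e_isWord_f i h)
      · exact fun y hy => (IsTri.car ⟨y, hy⟩).mem_triSpan
      · exact Submodule.span_le.2 fun y ⟨d, hd⟩ => (IsTri.neg d y hd).mem_triSpan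
  | zero => simp
  | add a b _ _ ha hb => rw [lie_add]; exact Submodule.add_mem _ ha hb
  | smul t a _ ha => rw [lie_smul]; exact Submodule.smul_mem _ _ ha

theorem lie_car_mem_triSpan (h : G.H) {x : g} (hx : x ∈ G.triSpan) :
    ⁅(h : g), x⁆ ∈ G.triSpan := by
  induction hx using Submodule.span_induction with
  | mem x hx =>
    obtain ⟨c, hc⟩ := hx
    have := hc.mem_wtSp h
    change ⁅(h : g), x⁆ = _ at this
    rw [this]
    exact Submodule.smul_mem _ _ hc.mem_triSpan
  | zero => simp
  | add a b _ _ ha hb => rw [lie_add]; exact Submodule.add_mem _ ha hb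
  | smul t a _ ha => rw [lie_smul]; exact Submodule.smul_mem _ _ ha

theorem triSpan_eq_top : G.triSpan = ⊤ := by
  have hgen : ∀ x : g, x ∈ LieSubalgebra.lieSpan ℂ g ((G.H : Set g) ∪ Set.range G.e ∪
      Set.range G.f) → ∀ y ∈ G.triSpan, ⁅x, y⁆ ∈ G.triSpan := by
    intro x hx
    induction hx using LieSubalgebra.lieSpan_induction with
    | mem x hx =>
      intro y hy
      rcases hx with (hx | ⟨i, rfl⟩) | ⟨i, rfl⟩
      · exact G.lie_car_mem_triSpan ⟨x, hx⟩ hy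
      · exact G.lie_e_mem_triSpan i hy
      · rw [← triSpan_opp] at hy ⊢
        exact G.opp.lie_e_mem_triSpan i hy
    | zero => simp
    | add a b _ _ ha hb =>
      intro y hy; rw [add_lie]; exact Submodule.add_mem _ (ha y hy) (hb y hy)
    | smul t a _ ha => intro y hy; rw [smul_lie]; exact Submodule.smul_mem _ _ (ha y hy)
    | lie a b _ _ ha hb =>
      intro y hy
      rw [lie_lie]
      exact Submodule.sub_mem _ (ha _ (hb y hy)) (hb _ (ha y hy))
  refine top_le_iff.1 fun x _ => ?_
  have hx : x ∈ LieSubalgebra.lieSpan ℂ g ((G.H : Set g) ∪ Set.range G.e ∪ Set.range G.f) := by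
    rw [G.generates]; trivial
  induction hx using LieSubalgebra.lieSpan_induction with
  | mem x hx =>
    rcases hx with (hx | ⟨i, rfl⟩) | ⟨i, rfl⟩
    · exact (IsTri.car ⟨x, hx⟩).mem_triSpan
    · exact (IsTri.pos _ _ (IsWord.gen i)).mem_triSpan
    · exact (IsTri.neg _ _ (IsWord.gen i)).mem_triSpan
  | zero => exact Submodule.zero_mem _
  | add a b _ _ ha hb => exact Submodule.add_mem _ (ha trivial) (hb trivial)
  | smul t a _ ha => exact Submodule.smul_mem _ _ (ha trivial)
  | lie a b ha' _ _ hb => exact hgen a ha' b (hb trivial)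

theorem wtSpace_eq_span {V : Type*} [AddCommGroup V] [Module ℂ V] {ι : V →ₗ[ℂ] g}
    (w : (I → ℤ) → Module.Dual ℂ V) (hw : ∀ c x, G.IsTri c x → x ∈ wtSpaceι ι (w c))
    (χ : Module.Dual ℂ V) :
    wtSpaceι ι χ = Submodule.span ℂ {x | ∃ c, G.IsTri c x ∧ w c = χ} := by
  refine (eq_wtSpace_of_le (ι := ι)
    (R := fun χ => Submodule.span ℂ {x | ∃ c, G.IsTri c x ∧ w c = χ}) (fun χ => ?_) ?_ χ).symm
  · refine Submodule.span_le.2 ?_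
    rintro x ⟨c, hc, rfl⟩
    exact hw c x hc
  · rw [← top_le_iff, ← G.triSpan_eq_top]
    refine Submodule.span_le.2 ?_
    rintro x ⟨c, hc⟩
    exact Submodule.mem_iSup_of_mem (w c) (Submodule.subset_span ⟨c, hc, rfl⟩)

theorem wtSp_wt_eq_span (c : I → ℤ) :
    G.wtSp (G.wt c) = Submodule.span ℂ {x | G.IsTri c x} := by
  rw [wtSp, G.wtSpace_eq_span G.wt (fun c x h => h.mem_wtSp)]
  congr 1
  ext x
  constructor
  · rintro ⟨d, hd, h⟩
    rwa [G.wt_injective h] at hd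
  · exact fun h => ⟨c, h, rfl⟩

theorem wtSp_wt_eq_span_isWord {c : I → ℤ} {i : I} (hc : 0 < c i) :
    G.wtSp (G.wt c) = Submodule.span ℂ {x | IsWord G.e c x} := by
  rw [wtSp_wt_eq_span]
  congr 1
  ext x
  refine ⟨fun h => ?_, fun h => IsTri.pos c x h⟩
  cases h with
  | pos c x h => exact h
  | car x => simp at hc
  | neg c x h => have := h.nonneg i; simp at hc; omega

theorem exists_isTri_of_wtSp_ne_bot {χ : Module.Dual ℂ G.H} (h : G.wtSp χ ≠ ⊥) :
    ∃ c x, G.IsTri c x ∧ x ≠ 0 ∧ χ = G.wt c := by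
  by_contra! hn
  refine h ?_
  rw [wtSp, G.wtSpace_eq_span G.wt (fun c x h => h.mem_wtSp), Submodule.span_eq_bot]
  rintro x ⟨c, hc, rfl⟩
  by_contra h0
  exact hn c x hc h0 rfl

/-- The coordinates of a weight of `g` all have the same sign. -/
theorem nonneg_or_nonpos_of_wtSp_ne_bot {c : I → ℤ} (h : G.wtSp (G.wt c) ≠ ⊥) :
    (∀ i, 0 ≤ c i) ∨ ∀ i, c i ≤ 0 := by
  obtain ⟨d, x, hd, -, hcd⟩ := G.exists_isTri_of_wtSp_ne_bot h
  rw [G.wt_injective hcd]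
  cases hd with
  | pos c x h => exact Or.inl h.nonneg
  | car x => exact Or.inl fun i => le_rfl
  | neg c x h => exact Or.inr fun i => by have := h.nonneg i; simpa using this

end KacMoodyAlgebra

end Triangular

end KMG

namespace KMG

section Sl2

variable {L : Type*} [LieRing L] [LieAlgebra ℂ L] {N : Type*} [AddCommGroup N] [Module ℂ N]
  [LieRingModule L N] [LieModule ℂ L N] {h e f : L}

theorem pow_toEnd_ne_zero {t : IsSl2Triple h e f} {v : N} {n : ℕ}
    (P : IsSl2Triple.HasPrimitiveVectorWith t v (n : ℂ)) :
    ∀ k ≤ n, ((LieModule.toEnd ℂ L N f) ^ k) v ≠ 0 := by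
  intro k
  induction k with
  | zero => intro _; simpa using P.ne_zero
  | succ k ih =>
    intro hk h0
    have h1 := P.lie_e_pow_succ_toEnd_f k
    rw [h0, lie_zero] at h1
    have h2 : ((k : ℂ) + 1) * ((n : ℂ) - k) ≠ 0 := by
      refine mul_ne_zero (by exact_mod_cast Nat.succ_ne_zero k) (sub_ne_zero.2 ?_)
      exact_mod_cast (by omega : n ≠ k)
    exact (smul_ne_zero h2 (ih (by omega))) h1.symm

theorem exists_nat_of_pow_toEnd_eq_zero {t : IsSl2Triple h e f} {v : N} {μ : ℂ}
    (P : IsSl2Triple.HasPrimitiveVectorWith t v μ)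
    (hN : ∃ k, ((LieModule.toEnd ℂ L N f) ^ k) v = 0) : ∃ n : ℕ, μ = n := by
  have h0 := Nat.find_spec hN
  have hmin := fun j => Nat.find_min hN (m := j)
  set k := Nat.find hN
  rcases Nat.eq_zero_or_pos k with hk | hk
  · rw [hk] at h0
    exact absurd (by simpa using h0) P.ne_zero
  · obtain ⟨j, hj⟩ : ∃ j, k = j + 1 := ⟨k - 1, by omega⟩
    rw [hj] at h0
    have h1 := P.lie_e_pow_succ_toEnd_f j
    rw [h0, lie_zero] at h1
    refine ⟨j, sub_eq_zero.1 ?_⟩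
    have h2 := (smul_eq_zero.1 h1.symm).resolve_right (hmin j (by omega))
    exact (mul_eq_zero.1 h2).resolve_left (by exact_mod_cast Nat.succ_ne_zero j)

end Sl2

section Strings

variable {g : Type*} [LieRing g] [LieAlgebra ℂ g]
variable {I : Type*} [Fintype I] [DecidableEq I] {A : Matrix I I ℤ}

namespace KacMoodyAlgebra

variable (G : KacMoodyAlgebra A g)

theorem lie_f_lie_f_car (i : I) (x : G.H) : ⁅G.f i, ⁅G.f i, (x : g)⁆⁆ = 0 := by
  rw [← lie_skew (G.f i) (x : g), G.lie_f, neg_smul, neg_neg, lie_smul, lie_self, smul_zero]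

theorem engel_f (i : I) : LieSubalgebra.engel ℂ (G.f i) = ⊤ := by
  refine top_le_iff.1 (G.generates ▸ LieSubalgebra.lieSpan_le.2 ?_)
  rintro x ((hx | ⟨j, rfl⟩) | ⟨j, rfl⟩)
  · rw [SetLike.mem_coe, LieSubalgebra.mem_engel_iff]
    exact ⟨2, G.lie_f_lie_f_car i ⟨x, hx⟩⟩
  · rw [SetLike.mem_coe, LieSubalgebra.mem_engel_iff]
    refine ⟨3, ?_⟩
    change ⁅G.f i, ⁅G.f i, ⁅G.f i, G.e j⁆⁆⁆ = 0
    rw [← lie_skew (G.f i) (G.e j), G.e_f]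
    split_ifs
    · rw [lie_neg, lie_neg, G.lie_f_lie_f_car, neg_zero]
    · simp
  · rw [SetLike.mem_coe, LieSubalgebra.mem_engel_iff]
    by_cases hij : i = j
    · subst hij
      exact ⟨1, by simp⟩
    · exact ⟨_, G.serre_f i j hij⟩

theorem exists_pow_ad_f_eq_zero (i : I) (x : g) : ∃ n, ((LieAlgebra.ad ℂ g (G.f i)) ^ n) x = 0 := by
  rw [← LieSubalgebra.mem_engel_iff, G.engel_f]
  trivial

theorem exists_pow_ad_e_eq_zero (i : I) (x : g) : ∃ n, ((LieAlgebra.ad ℂ g (G.e i)) ^ n) x = 0 :=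
  G.opp.exists_pow_ad_f_eq_zero i x

theorem root_coroot_self (hA : IsGCM A) (i : I) : G.root i (G.coroot i) = 2 := by
  rw [G.pairing, hA.1 i]
  norm_num

theorem isSl2Triple (hA : IsGCM A) (i : I) :
    IsSl2Triple (G.coroot i : g) (G.e i) (G.f i) where
  h_ne_zero h := by
    have h1 := G.root_coroot_self hA i
    have h2 : G.coroot i = 0 := Subtype.ext h
    rw [h2, map_zero] at h1
    norm_num at h1
  lie_e_f := by rw [G.e_f, if_pos rfl]
  lie_h_e_nsmul := by
    rw [G.lie_e, G.root_coroot_self hA, ← Nat.cast_smul_eq_nsmul ℂ]; norm_num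
  lie_h_f_nsmul := by
    rw [G.lie_f, G.root_coroot_self hA, ← Nat.cast_smul_eq_nsmul ℂ, neg_smul]; norm_num

theorem pow_ad_e_mem_wtSp (i : I) {χ : Module.Dual ℂ G.H} {x : g} (hx : x ∈ G.wtSp χ) (n : ℕ) :
    ((LieAlgebra.ad ℂ g (G.e i)) ^ n) x ∈ G.wtSp (χ + (n : ℂ) • G.root i) := by
  induction n with
  | zero => simpa using hx
  | succ n ih =>
    rw [pow_succ', Module.End.mul_apply]
    have h : χ + ((n + 1 : ℕ) : ℂ) • G.root i = G.root i + (χ + (n : ℂ) • G.root i) := by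
      push_cast
      rw [add_smul, one_smul]
      abel
    rw [h]
    exact lie_mem_wtSpace (G.e_mem_wtSp i) ih

theorem pow_ad_f_mem_wtSp (i : I) {χ : Module.Dual ℂ G.H} {x : g} (hx : x ∈ G.wtSp χ) (n : ℕ) :
    ((LieAlgebra.ad ℂ g (G.f i)) ^ n) x ∈ G.wtSp (χ - (n : ℂ) • G.root i) := by
  have h : χ - (n : ℂ) • G.root i = χ + (n : ℂ) • -G.root i := by
    rw [smul_neg, sub_eq_add_neg]
  rw [h]
  exact G.opp.pow_ad_e_mem_wtSp i hx n

/-- The weights on which `G.coroot i` is negative propagate upwards along the root string. -/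
theorem wtSp_add_ne_bot (hA : IsGCM A) (i : I) {χ : Module.Dual ℂ G.H} (h : G.wtSp χ ≠ ⊥) {n : ℕ}
    (hn : χ (G.coroot i) = -(n : ℂ)) {j : ℕ} (hj : j ≤ n) :
    G.wtSp (χ + (j : ℂ) • G.root i) ≠ ⊥ := by
  obtain ⟨u, hu, hu0⟩ := (Submodule.ne_bot_iff _).1 h
  have hex := G.exists_pow_ad_f_eq_zero i u
  have h0 := Nat.find_spec hex
  have hmin := fun j => Nat.find_min hex (m := j)
  set K := Nat.find hex
  obtain ⟨k, hk⟩ : ∃ k, K = k + 1 := by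
    refine ⟨K - 1, ?_⟩
    rcases Nat.eq_zero_or_pos K with hK | hK
    · rw [hK] at h0
      exact absurd (by simpa using h0) hu0
    · omega
  set v := ((LieAlgebra.ad ℂ g (G.f i)) ^ k) u with hv
  have hvw := G.pow_ad_f_mem_wtSp i hu k
  have P : IsSl2Triple.HasPrimitiveVectorWith (G.isSl2Triple hA i).symm v ((n + 2 * k : ℕ) : ℂ) :=
    { ne_zero := hmin k (by omega)
      lie_h := by
        rw [neg_lie]
        have h1 := hvw (G.coroot i)
        change ⁅(G.coroot i : g), v⁆ = _ at h1
        rw [h1, ← neg_smul, LinearMap.sub_apply, LinearMap.smul_apply, hn, G.root_coroot_self hA]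
        congr 1
        push_cast
        rw [smul_eq_mul]
        ring
      lie_e := by
        rw [hk, pow_succ'] at h0
        exact h0 }
  have h2 := pow_toEnd_ne_zero P (k + j) (by omega)
  have h3 := G.pow_ad_e_mem_wtSp i hvw (k + j)
  have h4 : χ + (j : ℂ) • G.root i =
      χ - (k : ℂ) • G.root i + ((k + j : ℕ) : ℂ) • G.root i := by
    push_cast
    rw [add_smul]
    abel
  rw [h4]
  exact (Submodule.ne_bot_iff _).2 ⟨_, h3, h2⟩

theorem wtSp_sub_ne_bot (hA : IsGCM A) (i : I) {χ : Module.Dual ℂ G.H} (h : G.wtSp χ ≠ ⊥) {n : ℕ}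
    (hn : χ (G.coroot i) = (n : ℂ)) {j : ℕ} (hj : j ≤ n) :
    G.wtSp (χ - (j : ℂ) • G.root i) ≠ ⊥ := by
  have h1 : χ - (j : ℂ) • G.root i = χ + (j : ℂ) • -G.root i := by
    rw [smul_neg, sub_eq_add_neg]
  rw [h1]
  exact G.opp.wtSp_add_ne_bot hA i (χ := χ) h (n := n) (by
    change χ (-G.coroot i) = _
    rw [map_neg, hn]) hj

/-- A vector killed by `f i` has non-positive `G.coroot i`-weight. -/
theorem exists_nat_of_lie_f_eq_zero (hA : IsGCM A) (i : I) {χ : Module.Dual ℂ G.H} {x : g}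
    (hx : x ∈ G.wtSp χ) (h0 : x ≠ 0) (hf : ⁅G.f i, x⁆ = 0) :
    ∃ n : ℕ, χ (G.coroot i) = -(n : ℂ) := by
  have P : IsSl2Triple.HasPrimitiveVectorWith (G.isSl2Triple hA i).symm x (-χ (G.coroot i)) :=
    { ne_zero := h0
      lie_h := by
        rw [neg_lie, neg_smul]
        exact congrArg _ (hx (G.coroot i))
      lie_e := hf }
  obtain ⟨n, hn⟩ := exists_nat_of_pow_toEnd_eq_zero P (G.exists_pow_ad_e_eq_zero i x)
  exact ⟨n, by rw [← hn, neg_neg]⟩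

end KacMoodyAlgebra

end Strings

end KMG

namespace KMG

section RootCombinatorics

variable {I : Type*} [Fintype I] [DecidableEq I] {A : Matrix I I ℤ}

/-- The symmetric form on the root lattice attached to a symmetrization of `A`. -/
def latForm (A : Matrix I I ℤ) (d : I → ℝ) (b c : I → ℤ) : ℝ :=
  ∑ i, d i * b i * (A.mulVec c i : ℝ)

theorem latForm_symm {d : I → ℝ} (hd : ∀ i j, d i * A i j = d j * A j i) (b c : I → ℤ) :
    latForm A d b c = latForm A d c b := by
  simp only [latForm, Matrix.mulVec, dotProduct, Int.cast_sum, Int.cast_mul, Finset.mul_sum]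
  rw [Finset.sum_comm]
  refine Finset.sum_congr rfl fun i _ => Finset.sum_congr rfl fun j _ => ?_
  linear_combination (b j * c i : ℝ) * hd j i

theorem mulVec_single_self (hA : IsGCM A) (i : I) (v : ℤ) :
    A.mulVec (Pi.single i v) i = 2 * v := by
  rw [Matrix.mulVec_single]
  simp [hA.1 i, mul_comm]

theorem latForm_reflect (hA : IsGCM A) {d : I → ℝ} (hd : ∀ i j, d i * A i j = d j * A j i)
    (c : I → ℤ) (i : I) :
    latForm A d (c - Pi.single i (A.mulVec c i)) (c - Pi.single i (A.mulVec c i)) =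
      latForm A d c c := by
  have add_l : ∀ a b c : I → ℤ, latForm A d (a - b) c = latForm A d a c - latForm A d b c := by
    intro a b c
    simp only [latForm, Pi.sub_apply, Int.cast_sub, mul_sub, sub_mul, Finset.sum_sub_distrib]
  have sing : ∀ (v : ℤ) (c : I → ℤ), latForm A d (Pi.single i v) c = d i * v * A.mulVec c i := by
    intro v c
    rw [latForm, Finset.sum_eq_single i]
    · simp
    · intro j _ hj; simp [hj]
    · simp
  rw [add_l, latForm_symm hd c, latForm_symm hd (Pi.single i _), add_l, add_l, sing, sing,
    latForm_symm hd c (Pi.single i _), sing, mulVec_single_self hA]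
  push_cast
  ring

/-- The combinatorial properties of the set of coordinate vectors of positive roots. -/
structure IsPosRootSet (A : Matrix I I ℤ) (R : Set (I → ℤ)) : Prop where
  nonneg : ∀ c ∈ R, ∀ i, 0 ≤ c i
  up : ∀ c ∈ R, ∀ i, ∀ n j : ℕ, A.mulVec c i = -n → j ≤ n → c + Pi.single i (j : ℤ) ∈ R
  down : ∀ c ∈ R, ∀ i, ∀ n j : ℕ, A.mulVec c i = n → j ≤ n → (∃ k, k ≠ i ∧ c k ≠ 0) →
    c - Pi.single i (j : ℤ) ∈ R
  connected : ∀ c ∈ R, ∀ T : Set I, (∃ i ∈ T, c i ≠ 0) → (∃ j ∉ T, c j ≠ 0) →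
    ∃ i ∈ T, ∃ j ∉ T, c i ≠ 0 ∧ c j ≠ 0 ∧ A i j ≠ 0

/-- All positive multiples of an antidominant root of negative norm are roots. -/
theorem IsPosRootSet.smul_mem_of_antidominant {R : Set (I → ℤ)} (hR : IsPosRootSet A R)
    (hA : IsGCM A) {d : I → ℝ} (hd0 : ∀ i, 0 < d i) (hd : ∀ i j, d i * A i j = d j * A j i)
    {c : I → ℤ} (hc : c ∈ R) (hneg : latForm A d c c < 0) (hu : ∀ i, A.mulVec c i ≤ 0)
    {n : ℕ} (hn : 1 ≤ n) : (n : ℤ) • c ∈ R := by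
  have hc0 := hR.nonneg c hc
  have hcn : c ≤ (n : ℤ) • c := fun i => by
    have := hc0 i
    simp only [Pi.smul_apply, smul_eq_mul]
    have hn' : (1 : ℤ) ≤ n := by exact_mod_cast hn
    nlinarith
  obtain ⟨b, hb, hmax⟩ := Finset.exists_max_image
    ((Finset.Icc c ((n : ℤ) • c)).filter (· ∈ R)) (fun b => ∑ i, b i)
    ⟨c, by simp only [Finset.mem_filter, Finset.mem_Icc]; exact ⟨⟨le_rfl, hcn⟩, hc⟩⟩
  simp only [Finset.mem_filter, Finset.mem_Icc] at hb hmax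
  obtain ⟨⟨hcb, hbn⟩, hbR⟩ := hb
  by_contra hcon
  obtain ⟨δ, hδ⟩ : ∃ δ, δ = (n : ℤ) • c - b := ⟨_, rfl⟩
  have hδ0 : ∀ i, 0 ≤ δ i := fun i => by
    have h : b i ≤ ((n : ℤ) • c) i := hbn i
    rw [hδ, Pi.sub_apply]
    omega
  obtain ⟨k, hk⟩ : ∃ k, δ k ≠ 0 := by
    by_contra! h
    exact hcon (by rw [← sub_eq_zero.1 (hδ ▸ funext h : (n : ℤ) • c - b = 0)] at hbR; exact hbR)
  have hw : ∀ i, δ i ≠ 0 → 0 ≤ A.mulVec b i := by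
    intro i hi
    by_contra! hlt
    have h1 := hR.up b hbR i (-A.mulVec b i).toNat 1 (by omega) (by omega)
    have h2 := hmax (b + Pi.single i 1) ⟨⟨?_, ?_⟩, h1⟩
    · simp [Finset.sum_add_distrib] at h2
    · intro j
      have h : c j ≤ b j := hcb j
      by_cases hij : j = i
      · subst hij; simp; omega
      · simp [hij]; omega
    · intro j
      have := hδ0 j
      have h : b j ≤ ((n : ℤ) • c) j := hbn j
      rw [hδ, Pi.sub_apply] at this hi
      by_cases hij : j = i
      · subst hij
        change b j + (Pi.single j 1 : I → ℤ) j ≤ ((n : ℤ) • c) j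
        rw [Pi.single_eq_same]
        omega
      · change (b + Pi.single i 1 : I → ℤ) j ≤ ((n : ℤ) • c) j
        rw [Pi.add_apply, Pi.single_eq_of_ne hij]
        exact (add_zero _).trans_le h
  have hz : ∀ i, A.mulVec δ i = n * A.mulVec c i - A.mulVec b i := fun i => by
    rw [hδ, Matrix.mulVec_sub, Matrix.mulVec_smul, Pi.sub_apply, Pi.smul_apply, smul_eq_mul]
  have hzout : ∀ i, δ i = 0 → ∀ j, A i j * δ j ≤ 0 := by
    intro i hi j
    by_cases hij : i = j
    · subst hij; rw [hi, mul_zero]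
    · exact mul_nonpos_of_nonpos_of_nonneg (hA.2.1 i j hij) (hδ0 j)
  have hznp : ∀ i, A.mulVec δ i ≤ 0 := by
    intro i
    by_cases hi : δ i = 0
    · exact Finset.sum_nonpos fun j _ => hzout i hi j
    · rw [hz]
      have := hw i hi
      have := mul_nonpos_of_nonneg_of_nonpos (Int.natCast_nonneg n) (hu i)
      omega
  have hb0 := hR.nonneg b hbR
  have h1 : ∀ i, 0 ≤ d i * δ i * (A.mulVec b i : ℝ) := by
    intro i
    by_cases hi : δ i = 0
    · simp [hi]
    · have e1 : (0 : ℝ) ≤ δ i := by exact_mod_cast hδ0 i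
      have e2 : (0 : ℝ) ≤ A.mulVec b i := by exact_mod_cast hw i hi
      have := (hd0 i).le
      positivity
  have h2 : ∀ i, d i * b i * (A.mulVec δ i : ℝ) ≤ 0 := by
    intro i
    have e1 : (0 : ℝ) ≤ b i := by exact_mod_cast hb0 i
    have e2 : (A.mulVec δ i : ℝ) ≤ 0 := by exact_mod_cast hznp i
    exact mul_nonpos_of_nonneg_of_nonpos (mul_nonneg (hd0 i).le e1) e2
  have h3 : latForm A d δ b = latForm A d b δ := latForm_symm hd _ _
  have h4 : latForm A d δ b = 0 := le_antisymm
    (h3.trans_le (Finset.sum_nonpos fun i _ => h2 i)) (Finset.sum_nonneg fun i _ => h1 i)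
  have h5 : ∀ i, δ i ≠ 0 → A.mulVec b i = 0 := by
    intro i hi
    have := (Finset.sum_eq_zero_iff_of_nonneg fun i _ => h1 i).1 h4 i (Finset.mem_univ i)
    have hd' := (hd0 i).ne'
    simp only [mul_eq_zero, Int.cast_eq_zero, hd', hi, false_or] at this
    exact this
  have h6 : ∀ i, b i ≠ 0 → A.mulVec δ i = 0 := by
    intro i hi
    have := (Finset.sum_eq_zero_iff_of_nonpos fun i _ => h2 i).1 (h3.symm.trans h4)
        i (Finset.mem_univ i)
    have hd' := (hd0 i).ne'
    simp only [mul_eq_zero, Int.cast_eq_zero, hd', hi, false_or] at this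
    exact this
  have hbc : ∀ i, c i ≠ 0 → b i ≠ 0 := fun i hi => by
    have := hc0 i
    have h : c i ≤ b i := hcb i
    omega
  have hδc : ∀ i, δ i ≠ 0 → c i ≠ 0 := fun i hi h => by
    have e1 : δ i = n * c i - b i := by rw [hδ]; simp
    have := hδ0 i
    have := hb0 i
    rw [h, mul_zero] at e1
    omega
  have hall : ∀ i, c i ≠ 0 → δ i ≠ 0 := by
    intro i hi hδi
    obtain ⟨p, hp, q, hq, hcp, -, hpq⟩ := hR.connected c hc {i | δ i = 0} ⟨i, hδi, hi⟩
      ⟨k, hk, hδc k hk⟩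
    have e1 : ∑ j, A p j * δ j = 0 := h6 p (hbc p hcp)
    have e2 := (Finset.sum_eq_zero_iff_of_nonpos fun j _ => hzout p hp j).1 e1 q
      (Finset.mem_univ q)
    exact (mul_ne_zero hpq hq) e2
  refine hneg.ne (Finset.sum_eq_zero fun i _ => ?_)
  by_cases hi : c i = 0
  · simp [hi]
  · have e1 := hz i
    rw [h5 i (hall i hi), h6 i (hbc i hi)] at e1
    have e2 : (n : ℤ) * A.mulVec c i = 0 := by omega
    have e3 : A.mulVec c i = 0 := (mul_eq_zero.1 e2).resolve_left (by omega)
    rw [e3]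
    simp

/-- All positive multiples of a root of negative norm are roots. -/
theorem IsPosRootSet.smul_mem {R : Set (I → ℤ)} (hR : IsPosRootSet A R)
    (hA : IsGCM A) {d : I → ℝ} (hd0 : ∀ i, 0 < d i) (hd : ∀ i j, d i * A i j = d j * A j i)
    {n : ℕ} (hn : 1 ≤ n) : ∀ (N : ℕ) (c : I → ℤ), c ∈ R → ∑ i, c i = N →
      latForm A d c c < 0 → (n : ℤ) • c ∈ R := by
  intro N
  induction N using Nat.strong_induction_on with
  | _ N ih =>
  intro c hc hN hneg
  by_cases hu : ∀ i, A.mulVec c i ≤ 0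
  · exact hR.smul_mem_of_antidominant hA hd0 hd hc hneg hu hn
  push Not at hu
  obtain ⟨i, hi⟩ := hu
  obtain ⟨v, hv⟩ : ∃ v : ℕ, A.mulVec c i = v := ⟨(A.mulVec c i).toNat, by omega⟩
  have hk : ∃ k, k ≠ i ∧ c k ≠ 0 := by
    by_contra! h
    refine hneg.not_ge (Finset.sum_nonneg fun j _ => ?_)
    by_cases hj : j = i
    · subst hj
      have e1 : (0 : ℝ) ≤ c j := by exact_mod_cast hR.nonneg c hc j
      have e2 : (0 : ℝ) ≤ A.mulVec c j := by exact_mod_cast hi.le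
      have := (hd0 j).le
      positivity
    · simp [h j hj]
  have hc' := hR.down c hc i v v hv le_rfl hk
  have href := latForm_reflect hA hd c i
  rw [hv] at href
  have hs : ∑ j, (c - Pi.single i (v : ℤ) : I → ℤ) j = N - v := by
    simp [Finset.sum_sub_distrib, hN]
  have hs0 : 0 ≤ ∑ j, (c - Pi.single i (v : ℤ) : I → ℤ) j :=
    Finset.sum_nonneg fun j _ => hR.nonneg _ hc' j
  have h1 := ih (N - v) (by omega) _ hc' (by omega) (by rw [href]; exact hneg)
  have h2 := hR.up _ h1 i (n * v) (n * v) (by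
    rw [Matrix.mulVec_smul, Matrix.mulVec_sub, Pi.smul_apply, Pi.sub_apply,
      mulVec_single_self hA, hv, smul_eq_mul]
    push_cast
    ring) le_rfl
  convert h2 using 1
  ext j
  by_cases hj : j = i
  · subst hj; simp; ring
  · simp [hj]

end RootCombinatorics

end KMG

namespace KMG

section InvariantForms

variable {g : Type*} [LieRing g] [LieAlgebra ℂ g]
variable {I : Type*} [Fintype I] [DecidableEq I] {A : Matrix I I ℤ}

namespace KacMoodyAlgebra

variable (G : KacMoodyAlgebra A g)

variable {G} in
theorem lie_e_isWord_eq_zero (i : I) {c : I → ℤ} {x : g} (h : IsWord G.e c x) (hi : c i = 0)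
    (hadj : ∀ j, c j ≠ 0 → A i j = 0) : ⁅G.e i, x⁆ = 0 := by
  have key : ∀ j, j ≠ i → A i j = 0 → ⁅G.e i, G.e j⁆ = 0 := by
    intro j hj h0
    have h1 := G.serre_e i j hj.symm
    rw [h0] at h1
    exact h1
  induction h with
  | gen j =>
    have hj : j ≠ i := by
      rintro rfl
      simp at hi
    exact key j hj (hadj j (by simp))
  | lie j c x hx ih =>
    have hc := hx.nonneg
    have hj : j ≠ i := by
      rintro rfl
      have := hc j
      simp at hi
      omega
    have hci : c i = 0 := by simpa [hj.symm] using hi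
    have h1 := ih hci fun k hk => hadj k (by
      have := hc k
      by_cases hkj : k = j
      · subst hkj; simp; omega
      · simpa [hkj] using hk)
    have h2 := key j hj (hadj j (by have := hc j; simp; omega))
    rw [leibniz_lie, h1, h2, zero_lie, lie_zero, add_zero]

variable {G} in
theorem connected_of_isWord (hA : IsGCM A) {c : I → ℤ} {x : g} (h : IsWord G.e c x)
    (hx : x ≠ 0) : ∀ T : Set I, (∃ i ∈ T, c i ≠ 0) → (∃ j ∉ T, c j ≠ 0) →
    ∃ i ∈ T, ∃ j ∉ T, c i ≠ 0 ∧ c j ≠ 0 ∧ A i j ≠ 0 := by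
  induction h with
  | gen k =>
    rintro T ⟨i, hi, hci⟩ ⟨j, hj, hcj⟩
    have h1 : i = k := by by_contra h; simp [h] at hci
    have h2 : j = k := by by_contra h; simp [h] at hcj
    exact absurd (h1 ▸ hi) (h2 ▸ hj)
  | lie k c x hw ih =>
    have hx0 : x ≠ 0 := by
      rintro rfl
      exact hx (lie_zero _)
    have hc := hw.nonneg
    have hmono : ∀ j, c j ≠ 0 → (c + Pi.single k 1 : I → ℤ) j ≠ 0 := by
      intro j hj
      have := hc j
      by_cases hkj : j = k
      · subst hkj; simp; omega
      · simpa [hkj] using hj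
    have hk : (c + Pi.single k 1 : I → ℤ) k ≠ 0 := by have := hc k; simp; omega
    have hsupp : ∀ j, (c + Pi.single k 1 : I → ℤ) j ≠ 0 → j = k ∨ c j ≠ 0 := by
      intro j hj
      by_cases hkj : j = k
      · exact Or.inl hkj
      · exact Or.inr (by simpa [hkj] using hj)
    rintro T ⟨i, hi, hci⟩ ⟨j, hj, hcj⟩
    by_cases hsplit : (∃ i ∈ T, c i ≠ 0) ∧ ∃ j ∉ T, c j ≠ 0
    · obtain ⟨p, hp, q, hq, h1, h2, h3⟩ := ih hx0 T hsplit.1 hsplit.2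
      exact ⟨p, hp, q, hq, hmono p h1, hmono q h2, h3⟩
    have hck : c k = 0 := by
      by_contra hne
      refine hsplit ⟨⟨i, hi, ?_⟩, ⟨j, hj, ?_⟩⟩
      · rcases hsupp i hci with rfl | h
        · exact hne
        · exact h
      · rcases hsupp j hcj with rfl | h
        · exact hne
        · exact h
    obtain ⟨l, hl, hkl⟩ : ∃ l, c l ≠ 0 ∧ A k l ≠ 0 := by
      by_contra! h
      exact hx (lie_e_isWord_eq_zero k hw hck h)
    by_cases hkT : k ∈ T
    · have hlT : l ∉ T := by
        intro hlT
        refine hsplit ⟨⟨l, hlT, hl⟩, ⟨j, hj, ?_⟩⟩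
        exact (hsupp j hcj).resolve_left fun h => hj (h ▸ hkT)
      exact ⟨k, hkT, l, hlT, hk, hmono l hl, hkl⟩
    · have hlT : l ∈ T := by
        by_contra hlT
        refine hsplit ⟨⟨i, hi, ?_⟩, ⟨l, hlT, hl⟩⟩
        exact (hsupp i hci).resolve_left fun h => hkT (h ▸ hi)
      exact ⟨l, hlT, k, hkT, hmono l hl, hk, fun h => hkl (hA.2.2 l k h)⟩

theorem wt_single_natCast (i : I) (j : ℕ) :
    G.wt (Pi.single i (j : ℤ)) = (j : ℂ) • G.root i := by
  have h : (Pi.single i (j : ℤ) : I → ℤ) = (j : ℤ) • Pi.single i 1 := by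
    rw [← Pi.single_smul]
    simp
  rw [h, wt_zsmul, wt_single]
  simp

theorem isPosRootSet (hA : IsGCM A) :
    IsPosRootSet A {c | (∀ i, 0 ≤ c i) ∧ c ≠ 0 ∧ G.wtSp (G.wt c) ≠ ⊥} where
  nonneg c hc := hc.1
  up := by
    rintro c ⟨h0, hne, hw⟩ i n j hn hj
    have h1 := G.wtSp_add_ne_bot hA i hw (n := n) (by
      rw [wt_coroot]
      change ((A.mulVec c i : ℤ) : ℂ) = _
      rw [hn]
      push_cast
      rfl) hj
    rw [← wt_single_natCast, ← wt_add] at h1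
    have hnn : ∀ k, (0 : ℤ) ≤ (Pi.single i (j : ℤ) : I → ℤ) k := fun k => by
      by_cases hk : k = i
      · subst hk; simp
      · simp [hk]
    refine ⟨fun k => add_nonneg (h0 k) (hnn k), fun h => hne (funext fun k => ?_), h1⟩
    have e1 := congrFun h k
    have e2 := hnn k
    have e3 := h0 k
    simp only [Pi.add_apply, Pi.zero_apply] at e1 ⊢
    omega
  down := by
    rintro c ⟨h0, hne, hw⟩ i n j hn hj ⟨k, hki, hk⟩
    have h1 := G.wtSp_sub_ne_bot hA i hw (n := n) (by
      rw [wt_coroot]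
      change ((A.mulVec c i : ℤ) : ℂ) = _
      rw [hn]
      push_cast
      rfl) hj
    rw [← wt_single_natCast, sub_eq_add_neg, ← wt_neg, ← wt_add, ← sub_eq_add_neg] at h1
    have e1 : (c - Pi.single i (j : ℤ) : I → ℤ) k = c k := by simp [hki]
    have e2 := h0 k
    refine ⟨(G.nonneg_or_nonpos_of_wtSp_ne_bot h1).resolve_right fun h => ?_, fun h => ?_, h1⟩
    · have e3 := h k
      rw [e1] at e3
      omega
    · rw [h] at e1
      exact hk e1.symm
  connected := by
    rintro c ⟨h0, hne, hw⟩
    obtain ⟨i, hi⟩ := Function.ne_iff.1 hne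
    have hi' : 0 < c i := lt_of_le_of_ne (h0 i) (Ne.symm hi)
    rw [G.wtSp_wt_eq_span_isWord hi', Ne, Submodule.span_eq_bot] at hw
    push Not at hw
    obtain ⟨x, hx, hx0⟩ := hw
    exact connected_of_isWord hA hx hx0

/-- All positive multiples of a root of negative norm are roots. -/
theorem wtSp_zsmul_ne_bot (hA : IsGCM A) {d : I → ℝ} (hd0 : ∀ i, 0 < d i)
    (hd : ∀ i j, d i * A i j = d j * A j i) {c : I → ℤ} (hc : G.wtSp (G.wt c) ≠ ⊥)
    (hneg : latForm A d c c < 0) {n : ℕ} (hn : 1 ≤ n) : G.wtSp (G.wt ((n : ℤ) • c)) ≠ ⊥ := by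
  have hc0 : c ≠ 0 := by
    rintro rfl
    simp [latForm] at hneg
  rcases G.nonneg_or_nonpos_of_wtSp_ne_bot hc with h | h
  · have hs : 0 ≤ ∑ i, c i := Finset.sum_nonneg fun i _ => h i
    exact ((G.isPosRootSet hA).smul_mem hA hd0 hd hn (∑ i, c i).toNat c ⟨h, hc0, hc⟩ (by omega)
      hneg).2.2
  · have h' : ∀ i, 0 ≤ (-c) i := fun i => neg_nonneg.2 (h i)
    have hs : 0 ≤ ∑ i, (-c) i := Finset.sum_nonneg fun i _ => h' i
    have hc' : G.opp.wtSp (G.opp.wt (-c)) ≠ ⊥ := by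
      rw [wt_opp, neg_neg]
      exact hc
    have := ((G.opp.isPosRootSet hA).smul_mem hA hd0 hd hn (∑ i, (-c) i).toNat (-c)
      ⟨h', neg_ne_zero.2 hc0, hc'⟩ (by omega) (by
        have : latForm A d (-c) (-c) = latForm A d c c := by
          simp [latForm, Matrix.mulVec_neg]
        rwa [this])).2.2
    rw [wt_opp, smul_neg, neg_neg] at this
    exact this

variable {G} in
theorem form_coroot {b : g →ₗ[ℂ] g →ₗ[ℂ] ℂ} (hb : ∀ x y z, b ⁅x, y⁆ z = b x ⁅y, z⁆) (i : I)
    (x : G.H) : b (G.coroot i) x = G.root i x * b (G.e i) (G.f i) := by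
  have h1 : ⁅G.e i, G.f i⁆ = (G.coroot i : g) := by rw [G.e_f, if_pos rfl]
  rw [← h1, hb, ← lie_skew, G.lie_f, neg_smul, neg_neg, map_smul, smul_eq_mul]

theorem exists_symmetrization (hA : IsGCM A) {Bf : g →ₗ[ℂ] g →ₗ[ℂ] ℂ}
    (hBf : NormalizedInvForm G Bf) :
    ∃ d : I → ℝ, (∀ i, 0 < d i) ∧ (∀ i j, d i * A i j = d j * A j i) ∧
      ∀ c : I → ℤ, ∃ t : G.H, (∀ x : G.H, Bf t x = G.wt c x) ∧
        ∀ c', G.wt c' t = (latForm A d c c' : ℂ) := by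
  obtain ⟨⟨hsymm, hinv, -⟩, hq⟩ := hBf
  choose q hq0 hq using hq
  have hη : ∀ i, Bf (G.e i) (G.f i) = ((q i / 2 : ℝ) : ℂ) := by
    intro i
    have h1 := form_coroot hinv i (G.coroot i)
    rw [hq, G.root_coroot_self hA] at h1
    push_cast
    linear_combination (-1 / 2 : ℂ) * h1
  have hq0' : ∀ i, (0 : ℝ) < q i / 2 := fun i => by
    have : (0 : ℝ) < q i := by exact_mod_cast hq0 i
    positivity
  refine ⟨fun i => (q i / 2 : ℝ)⁻¹, fun i => inv_pos.2 (hq0' i), fun i j => ?_, fun c => ?_⟩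
  · have h1 := hsymm (G.coroot i) (G.coroot j)
    rw [form_coroot hinv, form_coroot hinv, G.pairing, G.pairing, hη, hη] at h1
    have h2 : (A j i : ℝ) * (q i / 2) = A i j * (q j / 2) := by exact_mod_cast h1
    have h3 := (hq0' i).ne'
    have h4 := (hq0' j).ne'
    calc (q i / 2 : ℝ)⁻¹ * A i j
        = (q i / 2 : ℝ)⁻¹ * (q j / 2 : ℝ)⁻¹ * (A i j * (q j / 2)) := by
          rw [mul_comm (A i j : ℝ), mul_assoc, inv_mul_cancel_left₀ h4]
      _ = (q j / 2 : ℝ)⁻¹ * A j i := by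
          rw [← h2, mul_comm (A j i : ℝ), mul_comm (q i / 2 : ℝ)⁻¹, mul_assoc,
            inv_mul_cancel_left₀ h3]
  · refine ⟨∑ i, ((c i : ℂ) * ((q i / 2 : ℝ) : ℂ)⁻¹) • G.coroot i, fun x => ?_, fun c' => ?_⟩
    · have h0 : ∀ i, ((q i / 2 : ℝ) : ℂ) ≠ 0 := fun i => by exact_mod_cast (hq0' i).ne'
      simp only [Submodule.coe_sum, Submodule.coe_smul, map_sum, map_smul, LinearMap.sum_apply,
        LinearMap.smul_apply, form_coroot hinv, hη, wt, smul_eq_mul]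
      refine Finset.sum_congr rfl fun i _ => ?_
      have := h0 i
      field_simp
    · rw [map_sum]
      simp only [map_smul, wt_coroot, latForm, smul_eq_mul]
      push_cast
      refine Finset.sum_congr rfl fun i _ => ?_
      simp only [Matrix.mulVec, dotProduct]
      push_cast
      ring

end KacMoodyAlgebra

end InvariantForms

end KMG

namespace KMG

section PositiveForms

theorem sum_mul_self_of_sq_eq_diagonal_mul {J : Type*} [Fintype J] {Q : J → J → ℝ} {κ : J → ℝ}
    (hQ : ∀ j k, Q j k = Q k j) (h0 : ∀ j, 0 ≤ Q j j)
    (hκ : ∀ j l, ∑ k, Q j k * Q k l = κ j * Q j l) (q : J → ℝ) :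
    0 ≤ ∑ j, ∑ k, q j * q k * Q j k ∧
      (∑ j, ∑ k, q j * q k * Q j k = 0 → ∀ k, ∑ j, q j * Q j k = 0) := by
  have hrow : ∀ j, κ j ≤ 0 → ∀ k, Q j k = 0 := by
    intro j hj k
    have h1 : ∑ k, Q j k * Q k j ≤ 0 := by
      rw [hκ]
      exact mul_nonpos_of_nonpos_of_nonneg hj (h0 j)
    have h2 : ∀ k ∈ Finset.univ, 0 ≤ Q j k * Q k j := fun k _ => by
      rw [hQ k j]; exact mul_self_nonneg _
    have h3 := (Finset.sum_eq_zero_iff_of_nonneg h2).1 (le_antisymm h1 (Finset.sum_nonneg h2)) k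
      (Finset.mem_univ k)
    rw [hQ k j] at h3
    exact mul_self_eq_zero.1 h3
  have hpos : ∀ j k, Q j k ≠ 0 → 0 < κ j := by
    intro j k h
    by_contra! hle
    exact h (hrow j hle k)
  have heq : ∀ j l, Q j l ≠ 0 → κ j = κ l := by
    intro j l h
    have h1 : κ j * Q j l = κ l * Q l j := by
      rw [← hκ, ← hκ]
      exact Finset.sum_congr rfl fun k _ => by rw [hQ j k, hQ k l, mul_comm]
    rw [hQ l j] at h1
    exact mul_right_cancel₀ h h1
  set r : J → ℝ := fun j => (√(κ j))⁻¹ with hr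
  have hsq : ∑ j, ∑ k, q j * q k * Q j k = ∑ k, (∑ j, q j * r j * Q j k) ^ 2 := by
    have h1 : ∀ k, (∑ j, q j * r j * Q j k) ^ 2 =
        ∑ j, ∑ l, q j * q l * (r j * r l) * (Q j k * Q k l) := by
      intro k
      rw [pow_two, Finset.sum_mul_sum]
      refine Finset.sum_congr rfl fun j _ => Finset.sum_congr rfl fun l _ => ?_
      rw [hQ l k]
      ring
    simp only [h1]
    conv_rhs => rw [Finset.sum_comm]
    refine Finset.sum_congr rfl fun j _ => ?_
    conv_rhs => rw [Finset.sum_comm]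
    refine Finset.sum_congr rfl fun l _ => ?_
    rw [← Finset.mul_sum, hκ]
    by_cases h : Q j l = 0
    · simp [h]
    · have h2 := hpos j l h
      have h3 : √(κ j) ≠ 0 := (Real.sqrt_pos.2 h2).ne'
      have h4 : (√(κ j))⁻¹ * (√(κ j))⁻¹ * κ j = 1 := by
        rw [← mul_inv, Real.mul_self_sqrt h2.le, inv_mul_cancel₀ h2.ne']
      simp only [hr, ← heq j l h]
      linear_combination -(q j * q l * Q j l) * h4
  rw [hsq]
  refine ⟨Finset.sum_nonneg fun k _ => sq_nonneg _, fun h k => ?_⟩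
  have h1 := (Finset.sum_eq_zero_iff_of_nonneg fun k _ => sq_nonneg _).1 h k (Finset.mem_univ k)
  have h2 : ∑ j, q j * r j * Q j k = r k * ∑ j, q j * Q j k := by
    rw [Finset.mul_sum]
    refine Finset.sum_congr rfl fun j _ => ?_
    by_cases h : Q j k = 0
    · simp [h]
    · simp only [hr, heq j k h]
      ring
  rw [sq_eq_zero_iff, h2] at h1
  rcases mul_eq_zero.1 h1 with h3 | h3
  · refine Finset.sum_eq_zero fun j _ => ?_
    rw [hQ, hrow k ?_ j, mul_zero]
    exact Real.sqrt_eq_zero'.1 (inv_eq_zero.1 h3)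
  · exact h3

variable {g : Type*} [LieRing g] [LieAlgebra ℂ g]
variable {I : Type*} [Fintype I] [DecidableEq I] {A : Matrix I I ℤ}

theorem eq_gen_or_eq_zero_of_isWord {e : I → g} {s : I} {c : I → ℤ} {x : g} (h : IsWord e c x)
    (hc : ∀ j, j ≠ s → c j = 0) : (c = Pi.single s 1 ∧ x = e s) ∨ x = 0 := by
  induction h with
  | gen i =>
    have hi : i = s := by
      by_contra hi
      simpa using hc i hi
    subst hi
    exact Or.inl ⟨rfl, rfl⟩
  | lie i c x hw ih =>
    have hi : i = s := by
      by_contra hi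
      have h1 := hc i hi
      have h2 := hw.nonneg i
      simp at h1
      omega
    subst hi
    rcases ih fun j hj => by simpa [hj] using hc j hj with ⟨-, rfl⟩ | rfl
    · exact Or.inr (lie_self _)
    · exact Or.inr (lie_zero _)

namespace KacMoodyAlgebra

variable (G : KacMoodyAlgebra A g)

theorem wtSp_zsmul_root_eq_bot (i : I) {n : ℤ} (hn : 2 ≤ |n|) :
    G.wtSp ((n : ℂ) • G.root i) = ⊥ := by
  have key : ∀ (G' : KacMoodyAlgebra A g) {n : ℤ}, 2 ≤ n →
      G'.wtSp ((n : ℂ) • G'.root i) = ⊥ := by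
    intro G' n hn
    have hpos : 0 < (n • Pi.single i 1 : I → ℤ) i := by simp; omega
    rw [← wt_single, ← wt_zsmul, G'.wtSp_wt_eq_span_isWord hpos, Submodule.span_eq_bot]
    intro x hx
    refine (eq_gen_or_eq_zero_of_isWord (s := i) hx fun j hj => by simp [hj]).resolve_left ?_
    rintro ⟨h, -⟩
    have := congrFun h i
    simp at this
    omega
  rcases le_total 0 n with h | h
  · exact key G (by rwa [abs_of_nonneg h] at hn)
  · have h1 := key G.opp (n := -n) (by rwa [abs_of_nonpos h] at hn)
    have h2 : (n : ℂ) • G.root i = ((-n : ℤ) : ℂ) • -G.root i := by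
      push_cast
      rw [smul_neg, neg_smul, neg_neg]
    rw [h2]
    exact h1

theorem exists_dual_vector {Bf : g →ₗ[ℂ] g →ₗ[ℂ] ℂ} (hBf : InvariantForm Bf)
    {χ : Module.Dual ℂ G.H} {e : g} (he : e ∈ G.wtSp χ) (h0 : e ≠ 0) :
    ∃ f ∈ G.wtSp (-χ), Bf e f = 1 := by
  obtain ⟨hsymm, hinv, hnd⟩ := hBf
  obtain ⟨y, hy⟩ : ∃ y, Bf e y ≠ 0 := by
    by_contra! h
    exact h0 (hnd e h)
  obtain ⟨f, hf, hs, -⟩ := exists_wtSpace_decomp G.weight_decomp y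
  have h1 : Bf e y = Bf e (f (-χ)) := by
    rw [← hs, Finsupp.sum, map_sum]
    refine Finset.sum_eq_single (-χ) (fun ψ _ hψ => ?_) fun h => ?_
    · exact form_eq_zero_of_wtSpace hinv he (hf ψ) fun h => hψ (eq_neg_of_add_eq_zero_right h)
    · rw [Finsupp.notMem_support_iff.1 h, map_zero]
  rw [h1] at hy
  exact ⟨(Bf e (f (-χ)))⁻¹ • f (-χ), Submodule.smul_mem _ _ (hf _), by
    rw [map_smul, smul_eq_mul, inv_mul_cancel₀ hy]⟩

end KacMoodyAlgebra

end PositiveForms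

end KMG

namespace KMG

section PositiveForms

theorem trace_eq_sum_of_diagonal {J W : Type*} [Fintype J] [AddCommGroup W] [Module ℂ W]
    (b : Module.Basis J ℂ W) {T : W →ₗ[ℂ] W} {μ : J → ℂ} (h : ∀ j, T (b j) = μ j • b j) :
    LinearMap.trace ℂ W T = ∑ j, μ j := by
  rw [LinearMap.trace_eq_matrix_trace ℂ b, Matrix.trace]
  refine Finset.sum_congr rfl fun j _ => ?_
  rw [Matrix.diag_apply, LinearMap.toMatrix_apply, h, map_smul]
  simp

variable {g : Type*} [LieRing g] [LieAlgebra ℂ g]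

theorem coe_eq_sum_repr {J : Type*} [Fintype J] {L : LieSubalgebra ℂ g} (b : Module.Basis J ℂ L)
    (x : L) : (x : g) = ∑ j, b.repr x j • (b j : g) := by
  conv_lhs => rw [← b.sum_repr x, AddSubmonoidClass.coe_finsetSum]
  rfl

variable {I : Type*} [Fintype I] [DecidableEq I] {A : Matrix I I ℤ}

namespace KacMoodyAlgebra

variable (G : KacMoodyAlgebra A g)

/-- A finite dimensional subalgebra containing `H` has a basis of weight vectors. -/
theorem exists_basis_wtSp (L : LieSubalgebra ℂ g) [FiniteDimensional ℂ L]
    (hHL : G.H ≤ L.toSubmodule) :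
    ∃ (n : ℕ) (b : Module.Basis (Fin n) ℂ L) (c : Fin n → I → ℤ),
      ∀ j, (b j : g) ∈ G.wtSp (G.wt (c j)) := by
  have hs : ⊤ ≤ Submodule.span ℂ {x : L | ∃ c, (x : g) ∈ G.wtSp (G.wt c)} := by
    rintro ⟨x, hx⟩ -
    obtain ⟨f, hf, hsum, hN⟩ := exists_wtSpace_decomp G.weight_decomp x
    have hfL := hN L.toSubmodule (fun v y hy => L.lie_mem (hHL v.2) hy) hx
    have h1 : (⟨x, hx⟩ : L) = ∑ χ ∈ f.support, ⟨f χ, hfL χ⟩ := by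
      refine Subtype.ext (hsum.symm.trans ?_)
      rw [Finsupp.sum, AddSubmonoidClass.coe_finsetSum]
    rw [h1]
    refine Submodule.sum_mem _ fun χ hχ => Submodule.subset_span ?_
    obtain ⟨c, -, -, -, hc⟩ := G.exists_isTri_of_wtSp_ne_bot (χ := χ)
      ((Submodule.ne_bot_iff _).2 ⟨f χ, hf χ, Finsupp.mem_support_iff.1 hχ⟩)
    exact ⟨c, hc ▸ hf χ⟩
  have hsub := Module.Basis.ofSpan_subset hs
  have := Module.Finite.finite_basis (Module.Basis.ofSpan hs)
  have hmem : ∀ j, ∃ c, (Module.Basis.ofSpan hs j : g) ∈ G.wtSp (G.wt c) :=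
    fun j => hsub (Set.mem_range_self j)
  choose c hc using hmem
  refine ⟨_, (Module.Basis.ofSpan hs).reindex (Finite.equivFin _),
    fun j => c ((Finite.equivFin _).symm j), fun j => ?_⟩
  rw [Module.Basis.reindex_apply]
  exact hc _

theorem latForm_self_nonneg (hA : IsGCM A) {d : I → ℝ} (hd0 : ∀ i, 0 < d i)
    (hd : ∀ i j, d i * A i j = d j * A j i) {U : Submodule ℂ g} [FiniteDimensional ℂ U]
    {c : I → ℤ} (hU : ∀ k : ℤ, G.wtSp (G.wt (k • c)) ≤ U) (hc : G.wtSp (G.wt c) ≠ ⊥) :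
    0 ≤ latForm A d c c := by
  by_contra! hneg
  have hc0 : c ≠ 0 := by
    rintro rfl
    simp [latForm] at hneg
  have hfin := finite_wtSpace_le (ι := G.H.subtype) (U := U)
    (T := Set.range fun n : ℕ => G.wt (((n + 1 : ℕ) : ℤ) • c)) (by
      rintro _ ⟨n, rfl⟩
      exact ⟨G.wtSp_zsmul_ne_bot hA hd0 hd hc hneg (by omega), hU _⟩)
  refine Set.infinite_range_of_injective (fun n k h => ?_) hfin
  have h1 := smul_left_injective ℤ hc0 (G.wt_injective h)
  push_cast at h1
  omega

/-- The coroot of an `sl₂`-triple contained in a finite dimensional subalgebra containing `H`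
has positive norm. -/
theorem re_form_pos_of_sl2 (hA : IsGCM A) {Bf : g →ₗ[ℂ] g →ₗ[ℂ] ℂ} (hBf : NormalizedInvForm G Bf)
    (L : LieSubalgebra ℂ g) [FiniteDimensional ℂ L] (hHL : G.H ≤ L.toSubmodule)
    {h0 : G.H} {X Y : g} (hX : X ∈ L) (hY : Y ∈ L) (t : IsSl2Triple (h0 : g) X Y)
    (hL : ∀ c, ∀ x ∈ L, x ∈ G.wtSp (G.wt c) → x ≠ 0 →
      ∀ k : ℤ, G.wtSp (G.wt (k • c)) ≤ L.toSubmodule)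
    (hreal : ∀ c, ∀ x ∈ L, x ∈ G.wtSp (G.wt c) → x ≠ 0 → ∃ r : ℝ, G.wt c h0 = r) :
    0 < (Bf X Y).re := by
  obtain ⟨hsymm, hinv, hnd⟩ := hBf.1
  obtain ⟨d, hd0, hd, ht⟩ := G.exists_symmetrization hA hBf
  obtain ⟨n, b, c, hb⟩ := G.exists_basis_wtSp L hHL
  have hb0 : ∀ j, (b j : g) ≠ 0 := fun j h => b.ne_zero j (Subtype.ext h)
  have hbr : ∀ j (x : L) (y : G.H), (x : g) = y → ⁅x, b j⁆ = G.wt (c j) y • b j := by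
    intro j x y hxy
    ext
    rw [LieSubalgebra.coe_bracket, hxy]
    exact hb j y
  choose T hT1 hT2 using fun j => ht (c j)
  set Q : Fin n → Fin n → ℝ := fun j k => latForm A d (c j) (c k) with hQdef
  have hQ : ∀ j k, Q j k = Q k j := fun j k => latForm_symm hd _ _
  have hQ0 : ∀ j, 0 ≤ Q j j := fun j =>
    G.latForm_self_nonneg hA hd0 hd (U := L.toSubmodule) (hL (c j) _ (b j).2 (hb j) (hb0 j))
      ((Submodule.ne_bot_iff _).2 ⟨_, hb j, hb0 j⟩)
  have hκ : ∀ j, ∃ κ : ℝ, ∀ l, ∑ k, Q j k * Q k l = κ * Q j l := by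
    intro j
    obtain ⟨f, hf, hbf⟩ := G.exists_dual_vector hBf.1 (hb j) (hb0 j)
    have hfL : f ∈ L := hL (c j) _ (b j).2 (hb j) (hb0 j) (-1) (by
      rw [neg_one_smul, wt_neg]
      exact hf)
    have hbfH : ⁅(b j : g), f⁆ ∈ G.H := by
      rw [← G.mem_wtSp_zero, ← add_neg_cancel (G.wt (c j))]
      exact lie_mem_wtSpace (hb j) hf
    set τ : G.H := ⟨_, hbfH⟩ with hτ
    have hτ1 : ∀ x : G.H, Bf τ x = G.wt (c j) x := by
      intro x
      have h1 : ⁅(x : g), f⁆ = _ := hf x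
      rw [hτ, hinv, ← lie_skew, h1, LinearMap.neg_apply, neg_smul, neg_neg, map_smul, hbf,
        smul_eq_mul, mul_one]
    have hτ2 : ∀ k, G.wt (c k) τ = (Q j k : ℂ) := by
      intro k
      rw [← hT1, hsymm, hτ1, hT2, hQ j k]
    set τL : L := ⟨_, hHL hbfH⟩ with hτL
    set fL : L := ⟨f, hfL⟩ with hfL'
    have hlie : ⁅b j, fL⁆ = τL := rfl
    refine ⟨(LieModule.traceForm ℂ L L (b j) fL).re, fun l => ?_⟩
    set xL : L := ⟨T l, hHL (T l).2⟩ with hxL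
    have h1 := LieModule.traceForm_apply_lie_apply ℂ L L (b j) fL xL
    have h2 : ⁅fL, xL⁆ = (Q l j : ℂ) • fL := by
      ext
      have h3 : ⁅(T l : g), f⁆ = _ := hf (T l)
      rw [LieSubalgebra.coe_bracket, ← lie_skew]
      change -⁅(T l : g), f⁆ = (Q l j : ℂ) • f
      rw [h3, LinearMap.neg_apply, neg_smul, neg_neg, hT2]
    have h3 : LieModule.traceForm ℂ L L τL xL = ∑ k, (Q j k : ℂ) * (Q l k : ℂ) := by
      rw [LieModule.traceForm_apply_apply]
      refine trace_eq_sum_of_diagonal b fun k => ?_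
      rw [LinearMap.comp_apply, LieModule.toEnd_apply_apply, LieModule.toEnd_apply_apply,
        hbr k xL (T l) rfl, lie_smul, hbr k τL τ rfl, hT2, hτ2, smul_smul, mul_comm]
    rw [hlie, h3, h2, map_smul, smul_eq_mul] at h1
    have h4 := congrArg Complex.re h1
    simp only [Complex.re_sum, ← Complex.ofReal_mul, Complex.ofReal_re, Complex.re_ofReal_mul] at h4
    rw [hQ j l, mul_comm, ← h4]
    exact Finset.sum_congr rfl fun k _ => by rw [hQ k l]
  choose κ hκ using hκ
  set y := b.repr ⟨Y, hY⟩ with hy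
  set p : Fin n → ℂ := fun j => -(y j * Bf X (b j)) with hp
  have hYs : Y = ∑ j, y j • (b j : g) := coe_eq_sum_repr b ⟨Y, hY⟩
  have hform : ∀ x : G.H, Bf h0 x = ∑ j, p j * G.wt (c j) x := by
    intro x
    rw [← t.lie_e_f, hinv, ← lie_skew, hYs, lie_sum, map_neg, map_sum, ← Finset.sum_neg_distrib]
    refine Finset.sum_congr rfl fun j _ => ?_
    have h1 : ⁅(x : g), (b j : g)⁆ = _ := hb j x
    rw [lie_smul, h1, map_smul, map_smul, hp]
    simp only [smul_eq_mul]
    ring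
  choose r hr using fun j => hreal (c j) _ (b j).2 (hb j) (hb0 j)
  have hrQ : ∀ k, r k = ∑ j, (p j).re * Q j k := by
    intro k
    have h1 := hr k
    rw [← hT1, hsymm, hform] at h1
    have h2 := congrArg Complex.re h1
    simp only [hT2, Complex.re_sum, Complex.ofReal_re, Complex.re_mul_ofReal] at h2
    rw [← h2]
    exact Finset.sum_congr rfl fun j _ => by rw [hQ j k]
  have hnorm : (Bf h0 h0).re = ∑ j, ∑ k, (p j).re * (p k).re * Q j k := by
    rw [hform, Complex.re_sum]
    refine Finset.sum_congr rfl fun j _ => ?_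
    rw [hr, Complex.re_mul_ofReal, hrQ, Finset.mul_sum]
    exact Finset.sum_congr rfl fun k _ => by rw [hQ j k, mul_assoc]
  have h2 : Bf h0 h0 = 2 * Bf X Y := by
    conv_lhs => rw [← t.lie_e_f]
    rw [hinv, t.lie_e_f, ← lie_skew, t.lie_h_f_nsmul, neg_neg, map_nsmul, nsmul_eq_mul]
    push_cast
    rfl
  obtain ⟨h3, h4⟩ := sum_mul_self_of_sq_eq_diagonal_mul hQ hQ0 hκ fun j => (p j).re
  rw [← hnorm, h2] at h3 h4
  have h5 : (2 * Bf X Y).re = 2 * (Bf X Y).re := by simp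
  rw [h5] at h3 h4
  refine lt_of_le_of_ne (by linarith) fun h6 => ?_
  have h7 : ∀ k, r k = 0 := fun k => (hrQ k).trans (h4 (by rw [← h6, mul_zero]) k)
  have hXs : X = ∑ j, b.repr ⟨X, hX⟩ j • (b j : g) := coe_eq_sum_repr b ⟨X, hX⟩
  have h8 : ⁅(h0 : g), X⁆ = 0 := by
    rw [hXs, lie_sum]
    refine Finset.sum_eq_zero fun j _ => ?_
    have h1 : ⁅(h0 : g), (b j : g)⁆ = _ := hb j h0
    rw [lie_smul, h1, hr, h7]
    simp
  rw [t.lie_h_e_nsmul, ← Nat.cast_smul_eq_nsmul ℂ, smul_eq_zero] at h8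
  exact t.e_ne_zero (h8.resolve_left (by norm_num))

end KacMoodyAlgebra

end PositiveForms

end KMG

namespace KMG

section StringSubalgebra

variable {g : Type*} [LieRing g] [LieAlgebra ℂ g] {V : Type*} [AddCommGroup V] [Module ℂ V]

/-- The sum of the weight spaces of weights the integral multiples of `γ`. -/
def stringSubalgebra (ι : V →ₗ[ℂ] g) (γ : Module.Dual ℂ V) : LieSubalgebra ℂ g where
  toSubmodule := ⨆ n : ℤ, wtSpaceι ι ((n : ℂ) • γ)
  lie_mem' := by
    intro x y hx hy
    simp only [AddSubsemigroup.mem_carrier, AddSubmonoid.mem_toSubsemigroup,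
      Submodule.mem_toAddSubmonoid] at hx hy ⊢
    refine Submodule.iSup_induction _
        (motive := fun x => ⁅x, y⁆ ∈ ⨆ n : ℤ, wtSpaceι ι ((n : ℂ) • γ))
      hx (fun k x hx => ?_) (by simp) fun x x' h h' => by rw [add_lie]; exact add_mem h h'
    refine Submodule.iSup_induction _
        (motive := fun y => ⁅x, y⁆ ∈ ⨆ n : ℤ, wtSpaceι ι ((n : ℂ) • γ))
      hy (fun l y hy => ?_) (by simp) fun y y' h h' => by rw [lie_add]; exact add_mem h h'
    have h := lie_mem_wtSpace hx hy
    rw [← add_smul, ← Int.cast_add] at h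
    exact Submodule.mem_iSup_of_mem (k + l) h

variable {ι : V →ₗ[ℂ] g} {γ : Module.Dual ℂ V}

theorem wtSpace_le_stringSubalgebra (n : ℤ) :
    wtSpaceι ι ((n : ℂ) • γ) ≤ (stringSubalgebra ι γ).toSubmodule :=
  le_iSup (fun n : ℤ => wtSpaceι ι ((n : ℂ) • γ)) n

theorem exists_eq_zsmul_of_mem_stringSubalgebra {x : g} (hx : x ∈ stringSubalgebra ι γ)
    {χ : Module.Dual ℂ V} (hχ : x ∈ wtSpaceι ι χ) (h0 : x ≠ 0) : ∃ n : ℤ, χ = (n : ℂ) • γ := by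
  by_contra! hn
  have hx' : x ∈ ⨆ n : ℤ, wtSpaceι ι ((n : ℂ) • γ) := hx
  have hle : (⨆ n : ℤ, wtSpaceι ι ((n : ℂ) • γ)) ≤
      ⨆ θ ∈ {θ : Module.Dual ℂ V | θ ≠ χ}, wtSpaceι ι θ :=
    iSup_le fun n => le_iSup₂_of_le ((n : ℂ) • γ) (fun h => hn n h.symm) le_rfl
  have hx'' := hle hx'
  rw [iSup_subtype', Submodule.mem_iSup_iff_exists_finsupp] at hx''
  obtain ⟨f, hf, hs⟩ := hx''
  have h1 := mem_of_sum_wtSpace_mem (ι := ι) (N := ⊥) (by simp)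
    (insert χ (f.support.map (Function.Embedding.subtype _)))
    (fun θ => if h : θ ∈ {θ : Module.Dual ℂ V | θ ≠ χ} then f ⟨θ, h⟩ else -x)
    (fun θ hθ => by
      by_cases h : θ = χ
      · subst h
        simpa using hχ
      · have := hf ⟨θ, h⟩
        simpa [h] using this)
    (by
      rw [Finset.sum_insert (by simp), Finset.sum_map, Submodule.mem_bot]
      rw [Finsupp.sum] at hs
      rw [dif_neg (by simp), neg_add_eq_zero, ← hs]
      refine Finset.sum_congr rfl fun θ _ => ?_
      rw [dif_pos (by exact θ.2)]
      rfl) χ (Finset.mem_insert_self _ _)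
  rw [dif_neg (by simp)] at h1
  exact h0 (by simpa using h1)

end StringSubalgebra

section GradingForm

variable {I : Type*} [Fintype I] [DecidableEq I] {A : Matrix I I ℤ}
variable {g : Type*} [LieRing g] [LieAlgebra ℂ g]
variable {S : Type*} [Fintype S] [DecidableEq S] {B : Matrix S S ℤ}
variable {m : Type*} [LieRing m] [LieAlgebra ℂ m]

theorem IsFinGrading.finiteDimensional_stringSubalgebra {M : KacMoodyAlgebra B m}
    {φ : m →ₗ⁅ℂ⁆ g} (hgr : IsFinGrading M φ) (s : S) :
    FiniteDimensional ℂ (stringSubalgebra (φ.toLinearMap ∘ₗ M.H.subtype) (M.root s)) := by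
  obtain ⟨-, htop, hfin⟩ := hgr
  have hfd : ∀ χ, FiniteDimensional ℂ (wtSpaceι (φ.toLinearMap ∘ₗ M.H.subtype) χ) := by
    intro χ
    by_cases h : wtSpaceι (φ.toLinearMap ∘ₗ M.H.subtype) χ = ⊥
    · rw [h]; infer_instance
    · exact hfin χ (mem_of_iSup_wtSpace_eq_top htop h)
  have hbot : ∀ n : ℤ, 2 ≤ |n| →
      wtSpaceι (φ.toLinearMap ∘ₗ M.H.subtype) ((n : ℂ) • M.root s) = ⊥ := by
    intro n hn
    by_contra h
    rcases mem_of_iSup_wtSpace_eq_top htop h with h1 | h1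
    · have hn0 : (n : ℂ) ≠ 0 := by
        rw [Int.cast_ne_zero]; rintro rfl; simp at hn
      exact (smul_ne_zero hn0 (M.indepRoot.ne_zero s)) h1
    · exact h1.2 (M.wtSp_zsmul_root_eq_bot s hn)
  have hle : (stringSubalgebra (φ.toLinearMap ∘ₗ M.H.subtype) (M.root s)).toSubmodule ≤
      ⨆ k : Fin 3, wtSpaceι (φ.toLinearMap ∘ₗ M.H.subtype) (((k.1 : ℂ) - 1) • M.root s) := by
    refine iSup_le fun n => ?_
    by_cases hn : 2 ≤ |n|
    · rw [hbot n hn]; exact bot_le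
    · have h1 : n = -1 ∨ n = 0 ∨ n = 1 := by
        rw [not_le, abs_lt] at hn; omega
      rcases h1 with rfl | rfl | rfl
      · exact le_iSup_of_le 0 (by simp)
      · exact le_iSup_of_le 1 (by simp)
      · refine le_iSup_of_le 2 (le_of_eq ?_)
        congr 2
        norm_num
  exact Submodule.finiteDimensional_of_le hle

theorem re_form_pos (hA : IsGCM A) (hB : IsGCM B) (G : KacMoodyAlgebra A g)
    (M : KacMoodyAlgebra B m) {φ : m →ₗ⁅ℂ⁆ g} (hgr : IsFinGrading M φ)
    (hle : M.H.map φ.toLinearMap ≤ G.H) {Bf : g →ₗ[ℂ] g →ₗ[ℂ] ℂ} (hBf : NormalizedInvForm G Bf)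
    (s : S) : 0 < (Bf (φ (M.e s)) (φ (M.f s))).re := by
  set ψ : M.H →ₗ[ℂ] g := φ.toLinearMap ∘ₗ M.H.subtype with hψ
  have hψG : ∀ v, ψ v ∈ G.H := fun v => hle (Submodule.mem_map_of_mem v.2)
  let j : M.H →ₗ[ℂ] G.H := cartanIncl G M φ hle
  have hj : ∀ v, (j v : g) = ψ v := fun v => rfl
  have hres : ∀ χ, G.wtSp χ ≤ wtSpaceι ψ (χ ∘ₗ j) := fun χ x hx v => hx (j v)
  have := hgr.finiteDimensional_stringSubalgebra s
  have hlift : ∀ (χ : Module.Dual ℂ M.H) x, x ∈ M.wtSp χ → φ x ∈ wtSpaceι ψ χ := by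
    intro χ x hx v
    have h : ⁅(v : m), x⁆ = χ v • x := hx v
    change ⁅φ v, φ x⁆ = _
    rw [← LieHom.map_lie, h, map_smul]
  refine G.re_form_pos_of_sl2 hA hBf (stringSubalgebra ψ (M.root s)) (h0 := j (M.coroot s))
    ?_ ?_ ?_ ?_ ?_ ?_
  · refine le_trans ?_ (wtSpace_le_stringSubalgebra 0)
    intro x hx v
    rw [Int.cast_zero, zero_smul, LinearMap.zero_apply, zero_smul]
    exact G.abelian ⟨ψ v, hψG v⟩ ⟨x, hx⟩
  · have h := wtSpace_le_stringSubalgebra (ι := ψ) (γ := M.root s) 1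
    rw [Int.cast_one, one_smul] at h
    exact h (hlift _ _ (M.e_mem_wtSp s))
  · have h := wtSpace_le_stringSubalgebra (ι := ψ) (γ := M.root s) (-1)
    rw [Int.cast_neg, Int.cast_one, neg_smul, one_smul] at h
    exact h (hlift _ _ (M.f_mem_wtSp s))
  · have t := M.isSl2Triple hB s
    have hc : (j (M.coroot s) : g) = φ (M.coroot s) := rfl
    rw [hc]
    exact
      { h_ne_zero := fun h => t.h_ne_zero (hgr.1 (h.trans φ.map_zero.symm))
        lie_e_f := by rw [← LieHom.map_lie, t.lie_e_f]
        lie_h_e_nsmul := by rw [← LieHom.map_lie, t.lie_h_e_nsmul, map_nsmul]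
        lie_h_f_nsmul := by rw [← LieHom.map_lie, t.lie_h_f_nsmul, map_neg, map_nsmul] }
  · intro c x hxL hx h0 k
    obtain ⟨n, hn⟩ := exists_eq_zsmul_of_mem_stringSubalgebra hxL (hres _ hx) h0
    have h1 : (G.wt (k • c)) ∘ₗ j = ((k * n : ℤ) : ℂ) • M.root s := by
      rw [G.wt_zsmul, LinearMap.smul_comp, hn, smul_smul, Int.cast_mul]
    have h2 := hres (G.wt (k • c))
    rw [h1] at h2
    exact h2.trans (wtSpace_le_stringSubalgebra _)
  · intro c x hxL hx h0
    obtain ⟨n, hn⟩ := exists_eq_zsmul_of_mem_stringSubalgebra hxL (hres _ hx) h0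
    refine ⟨n * 2, ?_⟩
    have h1 := LinearMap.congr_fun hn (M.coroot s)
    rw [LinearMap.comp_apply, LinearMap.smul_apply, M.root_coroot_self hB] at h1
    rw [h1]
    simp

theorem symmetrizable_of_complex {S : Type*} [Finite S] {B : Matrix S S ℤ}
    {d : S → ℂ} (hd : ∀ s, d s ≠ 0)
    (h : ∀ s t, d s * (B s t : ℂ) = d t * (B t s : ℂ)) : Symmetrizable B := by
  obtain ⟨f, hf⟩ := Module.exists_dual_forall_apply_ne_zero (K := ℚ) d hd
  refine ⟨fun s => f (d s), hf, fun s t => ?_⟩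
  have h1 := congrArg f (h s t)
  have h2 : ∀ s t, d s * (B s t : ℂ) = (B s t : ℚ) • d s := by
    intro s t
    rw [Rat.smul_def]
    push_cast
    ring
  rw [h2, h2, map_smul, map_smul, smul_eq_mul, smul_eq_mul] at h1
  linear_combination h1

theorem symmetrizable_of_form (M : KacMoodyAlgebra B m) {b : m →ₗ[ℂ] m →ₗ[ℂ] ℂ}
    (hsymm : ∀ x y, b x y = b y x) (hb : ∀ x y z, b ⁅x, y⁆ z = b x ⁅y, z⁆)
    (hne : ∀ s, b (M.e s) (M.f s) ≠ 0) : Symmetrizable B := by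
  refine symmetrizable_of_complex (d := fun s => (b (M.e s) (M.f s))⁻¹)
    (fun s => inv_ne_zero (hne s)) fun s t => ?_
  have h1 := M.form_coroot hb s (M.coroot t)
  have h2 := M.form_coroot hb t (M.coroot s)
  rw [M.pairing] at h1 h2
  rw [hsymm, h1] at h2
  have hs := hne s
  have ht := hne t
  field_simp
  linear_combination -h2

end GradingForm

end KMG

namespace KMG

section Heights

variable {g : Type*} [LieRing g] [LieAlgebra ℂ g]
variable {I : Type*} [Fintype I] [DecidableEq I] {A : Matrix I I ℤ}

namespace KacMoodyAlgebra

variable (G : KacMoodyAlgebra A g)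

/-- The `n`-eigenspace of `ad h`. -/
def htSp (h : G.H) (n : ℤ) : Submodule ℂ g :=
  wtSpaceι (LinearMap.toSpanSingleton ℂ g (h : g)) ((n : ℂ) • LinearMap.id)

variable {G} {h : G.H}

theorem mem_htSp {n : ℤ} {x : g} : x ∈ G.htSp h n ↔ ⁅(h : g), x⁆ = (n : ℂ) • x := by
  constructor
  · intro hx
    have := hx 1
    simpa using this
  · intro hx v
    simp [smul_lie, hx, smul_smul, mul_comm]

theorem lie_mem_htSp {n k : ℤ} {x y : g} (hx : x ∈ G.htSp h n) (hy : y ∈ G.htSp h k) :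
    ⁅x, y⁆ ∈ G.htSp h (n + k) := by
  have := lie_mem_wtSpace hx hy
  rwa [← add_smul, ← Int.cast_add] at this

theorem form_htSp {b : g →ₗ[ℂ] g →ₗ[ℂ] ℂ} (hb : ∀ x y z, b ⁅x, y⁆ z = b x ⁅y, z⁆) {n k : ℤ}
    (hnk : n + k ≠ 0) {x y : g} (hx : x ∈ G.htSp h n) (hy : y ∈ G.htSp h k) : b x y = 0 := by
  refine form_eq_zero_of_wtSpace hb hx hy fun h0 => hnk ?_
  have := LinearMap.congr_fun h0 1
  simp only [LinearMap.add_apply, LinearMap.smul_apply, LinearMap.id_apply, smul_eq_mul,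
    mul_one, LinearMap.zero_apply] at this
  exact_mod_cast this

theorem htSp_opp (n : ℤ) : G.opp.htSp (-h : G.H) n = G.htSp h (-n) := by
  ext x
  refine (mem_htSp (G := G.opp) (h := (-h : G.H))).trans ?_
  rw [mem_htSp]
  change ⁅((-h : G.H) : g), x⁆ = _ ↔ _
  rw [Submodule.coe_neg, neg_lie, Int.cast_neg, neg_smul, neg_eq_iff_eq_neg]

theorem coe_mem_htSp (x : G.H) : (x : g) ∈ G.htSp h 0 := by
  rw [mem_htSp, G.abelian, Int.cast_zero, zero_smul]

theorem wt_height (h1 : ∀ i, G.root i h = 1) (c : I → ℤ) : G.wt c h = ((∑ i, c i : ℤ) : ℂ) := by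
  simp [wt, LinearMap.sum_apply, h1]

theorem e_mem_htSp (h1 : ∀ i, G.root i h = 1) (i : I) : G.e i ∈ G.htSp h 1 := by
  rw [mem_htSp, G.lie_e, h1, Int.cast_one]

theorem f_mem_htSp (h1 : ∀ i, G.root i h = 1) (i : I) : G.f i ∈ G.htSp h (-1) := by
  rw [mem_htSp, G.lie_f, h1]; simp

theorem IsTri.mem_htSp (h1 : ∀ i, G.root i h = 1)
    {c : I → ℤ} {x : g} (hx : G.IsTri c x) : x ∈ G.htSp h (∑ i, c i) := by
  rw [KacMoodyAlgebra.mem_htSp, ← wt_height h1]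
  exact hx.mem_wtSp h

theorem htSp_eq_span (h1 : ∀ i, G.root i h = 1) (n : ℤ) :
    G.htSp h n = Submodule.span ℂ {x | ∃ c, G.IsTri c x ∧ ∑ i, c i = n} := by
  rw [htSp, G.wtSpace_eq_span (fun c => ((∑ i, c i : ℤ) : ℂ) • LinearMap.id)
    fun c x hx => IsTri.mem_htSp h1 hx]
  congr 1
  ext x
  refine exists_congr fun c => and_congr_right fun _ => ?_
  constructor
  · intro h
    have := LinearMap.congr_fun h 1
    simp only [LinearMap.smul_apply, LinearMap.id_apply, smul_eq_mul, mul_one] at this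
    exact_mod_cast this
  · rintro rfl; rfl

theorem htSp_eq_span_isWord (h1 : ∀ i, G.root i h = 1) {n : ℤ} (hn : 1 ≤ n) :
    G.htSp h n = Submodule.span ℂ {x | ∃ c, IsWord G.e c x ∧ ∑ i, c i = n} := by
  rw [htSp_eq_span h1]
  congr 1
  ext x
  refine exists_congr fun c => and_congr_left fun hc => ⟨fun hx => ?_, fun hx => IsTri.pos c x hx⟩
  cases hx with
  | pos c x h => exact h
  | car x => simp at hc; omega
  | neg c x h => have := h.one_le_sum; simp at hc; omega

theorem mem_H_of_mem_htSp_zero (h1 : ∀ i, G.root i h = 1) {x : g} (hx : x ∈ G.htSp h 0) :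
    x ∈ G.H := by
  rw [htSp_eq_span h1] at hx
  refine Submodule.span_le.2 ?_ hx
  rintro y ⟨c, hy, hc⟩
  cases hy with
  | pos c x h => have := h.one_le_sum; omega
  | car x => exact x.2
  | neg c x h => have := h.one_le_sum; simp at hc; omega

theorem htSp_one_le (h1 : ∀ i, G.root i h = 1) : G.htSp h 1 ≤ Submodule.span ℂ (Set.range G.e) := by
  rw [htSp_eq_span_isWord h1 le_rfl]
  refine Submodule.span_mono ?_
  rintro x ⟨c, hx, hc⟩
  cases hx with
  | gen i => exact ⟨i, rfl⟩
  | lie i c x hx => have := hx.one_le_sum; simp [Finset.sum_add_distrib] at hc; omega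

theorem opp_root_neg (h1 : ∀ i, G.root i h = 1) (i : I) : G.opp.root i (-h : G.H) = 1 := by
  change (-G.root i) (-h) = 1
  rw [LinearMap.neg_apply, map_neg, neg_neg, h1]

theorem htSp_neg_one_le (h1 : ∀ i, G.root i h = 1) : G.htSp h (-1) ≤
    Submodule.span ℂ (Set.range G.f) := by
  rw [← htSp_opp]
  exact htSp_one_le (G := G.opp) (opp_root_neg h1)

theorem finiteDimensional_htSp (h1 : ∀ i, G.root i h = 1) {n : ℤ} (hn : 1 ≤ n) :
    FiniteDimensional ℂ (G.htSp h n) := by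
  have key : ∀ k : ℕ, {x | ∃ c, IsWord G.e c x ∧ ∑ i, c i = (k : ℤ)}.Finite := by
    intro k
    induction k with
    | zero =>
      refine Set.Finite.subset Set.finite_empty ?_
      rintro x ⟨c, hx, hc⟩
      have := hx.one_le_sum
      simp at hc; omega
    | succ k ih =>
      refine ((Set.finite_range G.e).union
        (Set.Finite.image2 (fun i x => ⁅G.e i, x⁆) Set.finite_univ ih)).subset ?_
      rintro x ⟨c, hx, hc⟩
      cases hx with
      | gen i => exact Or.inl ⟨i, rfl⟩
      | lie i c x hx =>
        refine Or.inr ⟨i, Set.mem_univ i, x, ⟨c, hx, ?_⟩, rfl⟩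
        simp [Finset.sum_add_distrib] at hc; omega
  rw [htSp_eq_span_isWord h1 hn]
  obtain ⟨k, rfl⟩ := Int.eq_ofNat_of_zero_le (by omega : 0 ≤ n)
  exact FiniteDimensional.span_of_finite ℂ (key k)

theorem finiteDimensional_htSp_neg (h1 : ∀ i, G.root i h = 1) {n : ℤ} (hn : 1 ≤ n) :
    FiniteDimensional ℂ (G.htSp h (-n)) := by
  rw [← htSp_opp]
  exact finiteDimensional_htSp (G := G.opp) (opp_root_neg h1) hn

theorem form_eq_zero_of_htSp (h1 : ∀ i, G.root i h = 1) {b : g →ₗ[ℂ] g →ₗ[ℂ] ℂ}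
    (hb : ∀ x y z, b ⁅x, y⁆ z = b x ⁅y, z⁆)
    {n : ℤ} {x : g} (hx : x ∈ G.htSp h n) (h0 : ∀ y ∈ G.htSp h (-n), b x y = 0) : b x = 0 := by
  ext y
  have hy : y ∈ G.triSpan := G.triSpan_eq_top ▸ Submodule.mem_top
  refine Submodule.span_induction (p := fun y _ => b x y = 0) ?_ (map_zero _)
    (fun y z _ _ hy hz => by rw [map_add, hy, hz, add_zero])
    (fun c y _ hy => by rw [map_smul, hy, smul_zero]) hy
  rintro y ⟨c, hc⟩
  have h2 := IsTri.mem_htSp h1 hc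
  by_cases h3 : ∑ i, c i = -n
  · exact h0 y (h3 ▸ h2)
  · exact form_htSp hb (by omega) hx h2

end KacMoodyAlgebra

end Heights

end KMG

namespace KMG

section DualFamilies

variable {g : Type*} [LieRing g] [LieAlgebra ℂ g]

/-- The families `x` and `y` are dual bases of `E` and `F` for the pairing `b`. -/
structure IsDualFamily (b : g →ₗ[ℂ] g →ₗ[ℂ] ℂ) (E F : Submodule ℂ g) {N : ℕ}
    (x y : Fin N → g) : Prop where
  left_mem : ∀ i, x i ∈ E
  right_mem : ∀ i, y i ∈ F
  left_sum : ∀ u ∈ E, ∑ i, b u (y i) • x i = u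
  right_sum : ∀ v ∈ F, ∑ i, b (x i) v • y i = v

theorem exists_isDualFamily {b : g →ₗ[ℂ] g →ₗ[ℂ] ℂ} {E F : Submodule ℂ g}
    [FiniteDimensional ℂ E] [FiniteDimensional ℂ F]
    (hE : ∀ u ∈ E, (∀ v ∈ F, b u v = 0) → u = 0) (hF : ∀ v ∈ F, (∀ u ∈ E, b u v = 0) → v = 0) :
    ∃ N, ∃ x y : Fin N → g, IsDualFamily b E F x y := by
  let β : E →ₗ[ℂ] Module.Dual ℂ F := (b.domRestrict₁₂ E F)
  let β' : F →ₗ[ℂ] Module.Dual ℂ E := β.flip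
  have hβ : Function.Injective β := (injective_iff_map_eq_zero β).2 fun u hu =>
    Subtype.ext (hE u u.2 fun v hv => LinearMap.congr_fun hu ⟨v, hv⟩)
  have hβ' : Function.Injective β' := (injective_iff_map_eq_zero β').2 fun v hv =>
    Subtype.ext (hF v v.2 fun u hu => LinearMap.congr_fun hv ⟨u, hu⟩)
  have h1 := LinearMap.finrank_le_finrank_of_injective hβ
  have h2 := LinearMap.finrank_le_finrank_of_injective hβ'
  rw [Subspace.dual_finrank_eq] at h1 h2
  have hsurj : Function.Surjective β' :=
    (LinearMap.injective_iff_surjective_of_finrank_eq_finrank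
      (by rw [Subspace.dual_finrank_eq]; omega)).1 hβ'
  let e := Module.finBasis ℂ E
  choose y hy using fun i => hsurj (e.coord i)
  have hy' : ∀ (u : E) i, b u (y i) = e.repr u i := fun u i => LinearMap.congr_fun (hy i) u
  have hleft : ∀ u ∈ E, ∑ i, b u (y i) • (e i : g) = u := by
    intro u hu
    have h3 := congrArg Subtype.val (e.sum_repr ⟨u, hu⟩)
    simp only [AddSubmonoidClass.coe_finsetSum, Submodule.coe_smul] at h3
    rw [← h3]
    refine Finset.sum_congr rfl fun i _ => ?_
    rw [← hy' ⟨u, hu⟩, h3]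
  refine ⟨_, fun i => e i, fun i => y i, fun i => (e i).2, fun i => (y i).2, hleft,
    fun v hv => ?_⟩
  refine sub_eq_zero.1 (hF _ (F.sub_mem (F.sum_mem fun i _ => F.smul_mem _ (y i).2) hv)
    fun u hu => ?_)
  conv_lhs => rw [map_sub, map_sum]
  rw [sub_eq_zero]
  conv_rhs => rw [← hleft u hu, map_sum, LinearMap.sum_apply]
  refine Finset.sum_congr rfl fun i _ => ?_
  rw [map_smul, map_smul, LinearMap.smul_apply, smul_eq_mul, smul_eq_mul, mul_comm]

end DualFamilies

end KMG

namespace KMG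

section Casimir

variable {g : Type*} [LieRing g] [LieAlgebra ℂ g]
variable {I : Type*} [Fintype I] [DecidableEq I] {A : Matrix I I ℤ}

theorem lie_form_left {b : g →ₗ[ℂ] g →ₗ[ℂ] ℂ} (hb : ∀ x y z, b ⁅x, y⁆ z = b x ⁅y, z⁆)
    (x y z : g) : b ⁅x, y⁆ z = -b y ⁅x, z⁆ := by
  rw [← lie_skew, map_neg, LinearMap.neg_apply, hb]

/-- The telescoping identity between dual families in consecutive degrees. -/
theorem IsDualFamily.sum_lie_add {b : g →ₗ[ℂ] g →ₗ[ℂ] ℂ}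
    (hb : ∀ x y z, b ⁅x, y⁆ z = b x ⁅y, z⁆) {E F E' F' : Submodule ℂ g} {N N' : ℕ}
    {x y : Fin N → g} {x' y' : Fin N' → g} (hd : IsDualFamily b E F x y)
    (hd' : IsDualFamily b E' F' x' y') {e : g} (hE : ∀ z ∈ E, ⁅e, z⁆ ∈ E')
    (hF : ∀ z ∈ F', ⁅e, z⁆ ∈ F) (u : g) :
    ∑ i, ⁅⁅e, x i⁆, ⁅y i, u⁆⁆ + ∑ j, ⁅x' j, ⁅⁅e, y' j⁆, u⁆⁆ = 0 := by
  have h1 : ∀ i, ⁅⁅e, x i⁆, ⁅y i, u⁆⁆ = ∑ j, b ⁅e, x i⁆ (y' j) • ⁅x' j, ⁅y i, u⁆⁆ := by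
    intro i
    conv_lhs => rw [← hd'.left_sum _ (hE _ (hd.left_mem i))]
    simp only [sum_lie, smul_lie]
  have h2 : ∀ j, ⁅x' j, ⁅⁅e, y' j⁆, u⁆⁆ = -∑ i, b ⁅e, x i⁆ (y' j) • ⁅x' j, ⁅y i, u⁆⁆ := by
    intro j
    conv_lhs => rw [← hd.right_sum _ (hF _ (hd'.right_mem j))]
    simp only [sum_lie, smul_lie, lie_sum, lie_smul, lie_form_left hb, neg_smul,
      Finset.sum_neg_distrib, neg_neg]
  simp only [h1, h2]
  rw [Finset.sum_neg_distrib, Finset.sum_comm, add_neg_cancel]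

theorem sum_Ico_telescope {V : Type*} [AddCommGroup V] {a c : ℕ → V} {n : ℕ}
    (h : ∀ k, 1 ≤ k → k + 1 < n → a k + c (k + 1) = 0) :
    ∀ j, 1 ≤ j → j < n → ∑ k ∈ Finset.Ico 1 (j + 1), (a k + c k) = a j + c 1 := by
  intro j hj
  induction j, hj using Nat.le_induction with
  | base => intro _; simp
  | succ j hj ih =>
    intro hn
    rw [Finset.sum_Ico_succ_top (by omega), ih (by omega)]
    calc a j + c 1 + (a (j + 1) + c (j + 1)) = (a j + c (j + 1)) + (a (j + 1) + c 1) := by abel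
      _ = _ := by rw [h j hj hn, zero_add]

namespace KacMoodyAlgebra

variable {G : KacMoodyAlgebra A g} {h : G.H} {b : g →ₗ[ℂ] g →ₗ[ℂ] ℂ}

theorem form_e_f_of_ne (hb : ∀ x y z, b ⁅x, y⁆ z = b x ⁅y, z⁆) {s t : I} (hst : s ≠ t) :
    b (G.e s) (G.f t) = 0 := by
  refine form_eq_zero_of_wtSpace hb (G.e_mem_wtSp s) (G.f_mem_wtSp t) fun h0 => hst ?_
  exact G.indepRoot.injective (add_neg_eq_zero.1 h0)

/-- Brackets of `e s` with elements of degree `-1`. -/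
theorem lie_e_of_mem_htSp_neg_one (h1 : ∀ i, G.root i h = 1)
    (hb : ∀ x y z, b ⁅x, y⁆ z = b x ⁅y, z⁆) (s : I) (hε : b (G.e s) (G.f s) ≠ 0) {y : g}
    (hy : y ∈ G.htSp h (-1)) :
    ⁅G.e s, y⁆ = (b (G.e s) y * (b (G.e s) (G.f s))⁻¹) • (G.coroot s : g) := by
  refine Submodule.span_induction
    (p := fun y _ => ⁅G.e s, y⁆ = (b (G.e s) y * (b (G.e s) (G.f s))⁻¹) • (G.coroot s : g))
    ?_ (by simp) ?_ ?_ (htSp_neg_one_le h1 hy)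
  · rintro _ ⟨t, rfl⟩
    rw [G.e_f]
    by_cases hst : t = s
    · subst hst
      rw [if_pos rfl, mul_inv_cancel₀ hε, one_smul]
    · rw [if_neg hst, form_e_f_of_ne hb (Ne.symm hst), zero_mul, zero_smul]
  · intro y z _ _ hy hz
    rw [lie_add, hy, hz, map_add, add_mul, add_smul]
  · intro c y _ hy
    rw [lie_smul, hy, map_smul, smul_smul, smul_eq_mul, mul_assoc]

theorem lie_e_lie (h1 : ∀ i, G.root i h = 1) (hb : ∀ x y z, b ⁅x, y⁆ z = b x ⁅y, z⁆) (s : I)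
    (hε : b (G.e s) (G.f s) ≠ 0) {k : ℤ} {χ : Module.Dual ℂ G.H} {y u : g}
    (hy : y ∈ G.htSp h (-k)) (hu : u ∈ G.htSp h k) (huχ : u ∈ G.wtSp χ) :
    ⁅G.e s, ⁅y, u⁆⁆ = ((b (G.e s) (G.f s))⁻¹ * χ (G.coroot s) * b u y) • G.e s := by
  have h2 : ⁅y, u⁆ ∈ G.htSp h 0 := by
    have := lie_mem_htSp hy hu
    rwa [neg_add_cancel] at this
  have h3 := mem_H_of_mem_htSp_zero h1 h2
  have h4 := G.form_coroot hb s ⟨_, h3⟩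
  have h5 : ⁅(G.coroot s : g), u⁆ = χ (G.coroot s) • u := huχ _
  have h6 : b (G.coroot s) ⁅y, u⁆ = -(χ (G.coroot s) * b u y) := by
    rw [← lie_skew, map_neg, ← hb, h5, map_smul, LinearMap.smul_apply, smul_eq_mul]
  rw [← lie_skew, G.lie_e ⟨_, h3⟩ s, ← neg_smul]
  congr 1
  rw [Subtype.coe_mk, h6] at h4
  field_simp
  linear_combination h4

/-- The partial Casimir operators. -/
def casimirSum {N : ℕ → ℕ} (x y : ∀ k, Fin (N k) → g) (j : ℕ) (z : g) : g :=
  ∑ k ∈ Finset.Ico 1 j, ∑ i, ⁅x k i, ⁅y k i, z⁆⁆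

variable {n : ℕ} {N : ℕ → ℕ} {x y : ∀ k, Fin (N k) → g}

theorem casimirSum_lie_e (h1 : ∀ i, G.root i h = 1) (hb : ∀ x y z, b ⁅x, y⁆ z = b x ⁅y, z⁆)
    (hd : ∀ k : ℕ, 1 ≤ k → k < n → IsDualFamily b (G.htSp h k) (G.htSp h (-k)) (x k) (y k))
    (s : I) (hε : b (G.e s) (G.f s) ≠ 0) {j : ℕ} (hj : 1 ≤ j) (hjn : j < n)
    {χ : Module.Dual ℂ G.H} {u : g} (hu : u ∈ G.htSp h j) (huχ : u ∈ G.wtSp χ) :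
    casimirSum x y (j + 1) ⁅G.e s, u⁆ = ⁅G.e s, casimirSum x y j u⁆ -
      (2 * (b (G.e s) (G.f s))⁻¹ * χ (G.coroot s)) • ⁅G.e s, u⁆ := by
  have he := e_mem_htSp h1 s
  have hL : ∀ z₁ z₂ : g, ⁅z₁, ⁅z₂, ⁅G.e s, u⁆⁆⁆ =
      ⁅G.e s, ⁅z₁, ⁅z₂, u⁆⁆⁆ - (⁅⁅G.e s, z₁⁆, ⁅z₂, u⁆⁆ + ⁅z₁, ⁅⁅G.e s, z₂⁆, u⁆⁆) := by
    intro z₁ z₂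
    rw [leibniz_lie (G.e s) z₁, leibniz_lie (G.e s) z₂, lie_add]
    abel
  have htel := sum_Ico_telescope (n := n) (a := fun k => ∑ i, ⁅⁅G.e s, x k i⁆, ⁅y k i, u⁆⁆)
    (c := fun k => ∑ i, ⁅x k i, ⁅⁅G.e s, y k i⁆, u⁆⁆) (fun k hk hkn => by
      refine (hd k hk (by omega)).sum_lie_add hb (hd (k + 1) (by omega) hkn)
        (fun z hz => ?_) (fun z hz => ?_) u
      · have := lie_mem_htSp he hz
        rwa [show (1 : ℤ) + k = (k + 1 : ℕ) by push_cast; ring] at this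
      · have := lie_mem_htSp he hz
        rwa [show (1 : ℤ) + -((k + 1 : ℕ) : ℤ) = -(k : ℤ) by push_cast; ring] at this) j hj hjn
  have hB : ∑ i, ⁅x 1 i, ⁅⁅G.e s, y 1 i⁆, u⁆⁆ =
      ((b (G.e s) (G.f s))⁻¹ * χ (G.coroot s)) • ⁅G.e s, u⁆ := by
    have hd1 := hd 1 le_rfl (by omega)
    have h2 : ∀ i, ⁅x 1 i, ⁅⁅G.e s, y 1 i⁆, u⁆⁆ =
        ((b (G.e s) (G.f s))⁻¹ * χ (G.coroot s)) • ⁅b (G.e s) (y 1 i) • x 1 i, u⁆ := by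
      intro i
      have h3 : ⁅(G.coroot s : g), u⁆ = χ (G.coroot s) • u := huχ _
      rw [lie_e_of_mem_htSp_neg_one h1 hb s hε (by simpa using hd1.right_mem i), smul_lie, h3,
        lie_smul, lie_smul, smul_lie, smul_smul, smul_smul]
      congr 1
      ring
    rw [Finset.sum_congr rfl fun i _ => h2 i, ← Finset.smul_sum, ← sum_lie,
      hd1.left_sum _ (by simpa using he)]
  have hA : ⁅G.e s, ∑ i, ⁅x j i, ⁅y j i, u⁆⁆⁆ - ∑ i, ⁅⁅G.e s, x j i⁆, ⁅y j i, u⁆⁆ =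
      -(((b (G.e s) (G.f s))⁻¹ * χ (G.coroot s)) • ⁅G.e s, u⁆) := by
    have hdj := hd j hj hjn
    rw [lie_sum, ← Finset.sum_sub_distrib]
    have h2 : ∀ i, ⁅G.e s, ⁅x j i, ⁅y j i, u⁆⁆⁆ - ⁅⁅G.e s, x j i⁆, ⁅y j i, u⁆⁆ =
        ((b (G.e s) (G.f s))⁻¹ * χ (G.coroot s)) • ⁅b u (y j i) • x j i, G.e s⁆ := by
      intro i
      rw [leibniz_lie (G.e s), add_sub_cancel_left,
        lie_e_lie h1 hb s hε (hdj.right_mem i) hu huχ, lie_smul, smul_lie, smul_smul]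
    rw [Finset.sum_congr rfl fun i _ => h2 i, ← Finset.smul_sum, ← sum_lie,
      hdj.left_sum _ hu, ← lie_skew, smul_neg]
  have hS : casimirSum x y (j + 1) ⁅G.e s, u⁆ = ⁅G.e s, casimirSum x y (j + 1) u⁆ -
      ∑ k ∈ Finset.Ico 1 (j + 1), (∑ i, ⁅⁅G.e s, x k i⁆, ⁅y k i, u⁆⁆ +
        ∑ i, ⁅x k i, ⁅⁅G.e s, y k i⁆, u⁆⁆) := by
    simp only [casimirSum, hL, lie_sum, Finset.sum_sub_distrib, Finset.sum_add_distrib]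
  have hT : casimirSum x y (j + 1) u = casimirSum x y j u + ∑ i, ⁅x j i, ⁅y j i, u⁆⁆ :=
    Finset.sum_Ico_succ_top hj _
  rw [hS, htel, hB, hT, lie_add, add_sub_assoc, ← sub_sub, hA, mul_assoc, two_mul, add_smul]
  abel

/-- The eigenvalues of the Casimir operators. -/
def casimirCoeff (G : KacMoodyAlgebra A g) (b : g →ₗ[ℂ] g →ₗ[ℂ] ℂ) (c : I → ℤ) : ℂ :=
  ∑ s, (c s : ℂ) * (b (G.e s) (G.f s))⁻¹ * (2 - G.wt c (G.coroot s))

theorem casimirCoeff_single (hA : IsGCM A) (s : I) : casimirCoeff G b (Pi.single s 1) = 0 := by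
  rw [casimirCoeff, Finset.sum_eq_single s]
  · rw [G.wt_single, G.root_coroot_self hA, sub_self, mul_zero]
  · intro t _ hts
    rw [Pi.single_eq_of_ne hts, Int.cast_zero, zero_mul, zero_mul]
  · simp

theorem form_coroot_symm (hsymm : ∀ x y, b x y = b y x)
    (hb : ∀ x y z, b ⁅x, y⁆ z = b x ⁅y, z⁆) (hε : ∀ s, b (G.e s) (G.f s) ≠ 0) (s t : I) :
    (b (G.e t) (G.f t))⁻¹ * G.root s (G.coroot t) =
      (b (G.e s) (G.f s))⁻¹ * G.root t (G.coroot s) := by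
  have h1 := G.form_coroot hb s (G.coroot t)
  have h2 := G.form_coroot hb t (G.coroot s)
  rw [hsymm, h1] at h2
  have hs := hε s
  have ht := hε t
  field_simp
  linear_combination h2

theorem casimirCoeff_add_single (hA : IsGCM A) (hsymm : ∀ x y, b x y = b y x)
    (hb : ∀ x y z, b ⁅x, y⁆ z = b x ⁅y, z⁆) (hε : ∀ s, b (G.e s) (G.f s) ≠ 0) (c : I → ℤ)
    (s : I) : casimirCoeff G b (c + Pi.single s 1) =
      casimirCoeff G b c - 2 * (b (G.e s) (G.f s))⁻¹ * G.wt c (G.coroot s) := by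
  have h1 : ∀ t, ((c + Pi.single s 1 : I → ℤ) t : ℂ) * (b (G.e t) (G.f t))⁻¹ *
      (2 - G.wt (c + Pi.single s 1) (G.coroot t)) =
      (c t : ℂ) * (b (G.e t) (G.f t))⁻¹ * (2 - G.wt c (G.coroot t)) -
      (b (G.e s) (G.f s))⁻¹ * ((c t : ℂ) * G.root t (G.coroot s)) +
      (if t = s then (b (G.e s) (G.f s))⁻¹ * -G.wt c (G.coroot s) else 0) := by
    intro t
    have h2 := form_coroot_symm hsymm hb hε s t
    rw [G.wt_add, G.wt_single, LinearMap.add_apply, Pi.add_apply]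
    by_cases hts : t = s
    · subst hts
      rw [if_pos rfl, Pi.single_eq_same, G.root_coroot_self hA]
      push_cast
      ring
    · rw [if_neg hts, Pi.single_eq_of_ne hts, add_zero, add_zero]
      linear_combination -(c t : ℂ) * h2
  have h3 : ∑ t, (c t : ℂ) * G.root t (G.coroot s) = G.wt c (G.coroot s) := by
    simp [wt, LinearMap.sum_apply]
  rw [casimirCoeff, Finset.sum_congr rfl fun t _ => h1 t, Finset.sum_add_distrib,
    Finset.sum_sub_distrib, ← Finset.mul_sum, h3, Finset.sum_ite_eq', if_pos (Finset.mem_univ s),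
    casimirCoeff]
  ring

theorem casimirSum_isWord (hA : IsGCM A) (h1 : ∀ i, G.root i h = 1)
    (hsymm : ∀ x y, b x y = b y x) (hb : ∀ x y z, b ⁅x, y⁆ z = b x ⁅y, z⁆)
    (hε : ∀ s, b (G.e s) (G.f s) ≠ 0)
    (hd : ∀ k : ℕ, 1 ≤ k → k < n → IsDualFamily b (G.htSp h k) (G.htSp h (-k)) (x k) (y k))
    {c : I → ℤ} {z : g} (hz : IsWord G.e c z) :
    ∀ j : ℕ, j ≤ n → ∑ i, c i = j → casimirSum x y j z = casimirCoeff G b c • z := by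
  induction hz with
  | gen s =>
    intro j _ hj
    have hj1 : j = 1 := by simp at hj; omega
    rw [hj1, casimirCoeff_single hA, zero_smul, casimirSum, Finset.Ico_self, Finset.sum_empty]
  | lie s c u hu ih =>
    intro j hjn hj
    have h2 := hu.one_le_sum
    simp only [Pi.add_apply, Finset.sum_add_distrib, Finset.sum_pi_single', Finset.mem_univ,
      if_true] at hj
    obtain ⟨i, rfl⟩ : ∃ i, j = i + 1 := ⟨j - 1, by omega⟩
    have h3 : ∑ i, c i = i := by push_cast at hj; omega
    have hu' : u ∈ G.htSp h i := h3 ▸ IsTri.mem_htSp h1 (IsTri.pos c u hu)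
    rw [casimirSum_lie_e h1 hb hd s (hε s) (by omega) (by omega) hu' (isWord_mem_wtSp hu),
      ih i (by omega) h3, lie_smul, ← sub_smul, casimirCoeff_add_single hA hsymm hb hε]

end KacMoodyAlgebra

end Casimir

end KMG

namespace KMG

section Radical

variable {g : Type*} [LieRing g] [LieAlgebra ℂ g]
variable {I : Type*} [Fintype I] [DecidableEq I] {A : Matrix I I ℤ}

theorem lie_mem_ker_form {b : g →ₗ[ℂ] g →ₗ[ℂ] ℂ} (hb : ∀ x y z, b ⁅x, y⁆ z = b x ⁅y, z⁆)
    (y : g) {x : g} (hx : x ∈ LinearMap.ker b) : ⁅y, x⁆ ∈ LinearMap.ker b := by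
  rw [LinearMap.mem_ker] at hx ⊢
  ext z
  rw [lie_form_left hb, hx, LinearMap.zero_apply, neg_zero, LinearMap.zero_apply]

namespace KacMoodyAlgebra

variable {G : KacMoodyAlgebra A g} {h : G.H} {b : g →ₗ[ℂ] g →ₗ[ℂ] ℂ}

theorem exists_isDualFamily_htSp (h1 : ∀ i, G.root i h = 1) (hsymm : ∀ x y, b x y = b y x)
    (hb : ∀ x y z, b ⁅x, y⁆ z = b x ⁅y, z⁆) {k : ℕ} (hk : 1 ≤ k)
    (hpos : ∀ x ∈ LinearMap.ker b, x ∈ G.htSp h k → x = 0)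
    (hneg : ∀ x ∈ LinearMap.ker b, x ∈ G.htSp h (-k) → x = 0) :
    ∃ N, ∃ x y : Fin N → g, IsDualFamily b (G.htSp h k) (G.htSp h (-k)) x y := by
  have := finiteDimensional_htSp h1 (n := k) (by exact_mod_cast hk)
  have := finiteDimensional_htSp_neg h1 (n := k) (by exact_mod_cast hk)
  refine exists_isDualFamily (fun u hu h0 => hpos u ?_ hu) fun v hv h0 => hneg v ?_ hv
  · exact form_eq_zero_of_htSp h1 hb hu h0
  · refine form_eq_zero_of_htSp h1 hb hv fun y hy => ?_
    rw [neg_neg] at hy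
    rw [hsymm, h0 y hy]

theorem casimirSum_eq_zero
    (hb : ∀ x y z, b ⁅x, y⁆ z = b x ⁅y, z⁆) {n : ℕ} {N : ℕ → ℕ} {x y : ∀ k, Fin (N k) → g}
    (hd : ∀ k : ℕ, 1 ≤ k → k < n → IsDualFamily b (G.htSp h k) (G.htSp h (-k)) (x k) (y k))
    (hpos : ∀ k : ℕ, 1 ≤ k → k < n → ∀ x ∈ LinearMap.ker b, x ∈ G.htSp h k → x = 0)
    {z : g} (hz : z ∈ LinearMap.ker b) (hzn : z ∈ G.htSp h n) : casimirSum x y n z = 0 := by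
  refine Finset.sum_eq_zero fun k hk => Finset.sum_eq_zero fun i _ => ?_
  rw [Finset.mem_Ico] at hk
  have h2 := lie_mem_htSp ((hd k hk.1 hk.2).right_mem i) hzn
  rw [show -(k : ℤ) + n = (n - k : ℕ) by omega] at h2
  rw [hpos (n - k) (by omega) (by omega) _ (lie_mem_ker_form hb _ hz) h2, lie_zero]

theorem casimirCoeff_re_pos (hε : ∀ s, 0 < (b (G.e s) (G.f s)).re) {c : I → ℤ}
    (hc : ∀ i, 0 ≤ c i) (hc0 : ∃ i, 0 < c i)
    (hp : ∀ s, ∃ p : ℕ, G.wt c (G.coroot s) = -(p : ℂ)) : 0 < (casimirCoeff G b c).re := by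
  choose p hp using hp
  have h2 : ∀ s, ((c s : ℂ) * (b (G.e s) (G.f s))⁻¹ * (2 - G.wt c (G.coroot s))).re =
      c s * ((b (G.e s) (G.f s))⁻¹).re * (2 + p s) := by
    intro s
    rw [hp, show (2 : ℂ) - -(p s : ℂ) = ((2 + p s : ℝ) : ℂ) by push_cast; ring,
      Complex.re_mul_ofReal, ← Complex.ofReal_intCast, Complex.re_ofReal_mul]
  have h3 : ∀ s, 0 < ((b (G.e s) (G.f s))⁻¹).re := by
    intro s
    rw [Complex.inv_re]
    refine div_pos (hε s) (Complex.normSq_pos.2 fun h0 => ?_)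
    have := hε s
    rw [h0] at this
    simp at this
  rw [casimirCoeff, Complex.re_sum, Finset.sum_congr rfl fun s _ => h2 s]
  refine Finset.sum_pos' (fun s _ => ?_) ?_
  · have := (h3 s).le
    have h4 : (0 : ℝ) ≤ c s := by exact_mod_cast hc s
    positivity
  · obtain ⟨i, hi⟩ := hc0
    refine ⟨i, Finset.mem_univ i, ?_⟩
    have := h3 i
    have h4 : (0 : ℝ) < c i := by exact_mod_cast hi
    positivity

theorem eq_zero_of_mem_ker_form_of_lt (hA : IsGCM A) (h1 : ∀ i, G.root i h = 1)
    (hsymm : ∀ x y, b x y = b y x) (hb : ∀ x y z, b ⁅x, y⁆ z = b x ⁅y, z⁆)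
    (hε : ∀ s, 0 < (b (G.e s) (G.f s)).re) {n : ℕ} (hn : 1 ≤ n)
    (hpos : ∀ k : ℕ, 1 ≤ k → k < n → ∀ x ∈ LinearMap.ker b, x ∈ G.htSp h k → x = 0)
    (hneg : ∀ k : ℕ, 1 ≤ k → k < n → ∀ x ∈ LinearMap.ker b, x ∈ G.htSp h (-k) → x = 0)
    {x : g} (hx : x ∈ LinearMap.ker b) (hxn : x ∈ G.htSp h n) : x = 0 := by
  have hε0 : ∀ s, b (G.e s) (G.f s) ≠ 0 := fun s h0 => by
    have := hε s
    rw [h0] at this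
    simp at this
  have hdual : ∀ k : ℕ, ∃ N, ∃ x y : Fin N → g, 1 ≤ k → k < n →
      IsDualFamily b (G.htSp h k) (G.htSp h (-k)) x y := by
    intro k
    by_cases hk : 1 ≤ k ∧ k < n
    · obtain ⟨N, x, y, hd⟩ := exists_isDualFamily_htSp h1 hsymm hb hk.1 (hpos k hk.1 hk.2)
        (hneg k hk.1 hk.2)
      exact ⟨N, x, y, fun _ _ => hd⟩
    · exact ⟨0, 0, 0, fun h2 h3 => absurd ⟨h2, h3⟩ hk⟩
  choose N X Y hd using hdual
  have hlief : ∀ s, ∀ z ∈ LinearMap.ker b, z ∈ G.htSp h n → ⁅G.f s, z⁆ = 0 := by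
    intro s z hz hzn
    by_cases hn1 : n = 1
    · subst hn1
      have h2 := lie_e_of_mem_htSp_neg_one (G := G.opp) (h := (-h : G.H)) (opp_root_neg h1) hb s
        (y := z) (by rw [hsymm]; exact hε0 s) (by rw [htSp_opp]; simpa using hzn)
      have h3 : b (G.f s) z = 0 := by
        rw [hsymm, LinearMap.mem_ker.1 hz, LinearMap.zero_apply]
      change ⁅G.f s, z⁆ = (b (G.f s) z * _) • _ at h2
      rw [h2, h3, zero_mul, zero_smul]
    · refine hpos (n - 1) (by omega) (by omega) _ (lie_mem_ker_form hb _ hz) ?_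
      have h2 := lie_mem_htSp (f_mem_htSp h1 s) hzn
      rwa [show (-1 : ℤ) + n = (n - 1 : ℕ) by omega] at h2
  obtain ⟨f, hf, hs, hN⟩ := exists_wtSpace_decomp G.weight_decomp x
  have hfK := hN (LinearMap.ker b ⊓ G.htSp h n)
    (fun v x hx => ⟨lie_mem_ker_form hb _ hx.1, by
      have := lie_mem_htSp (coe_mem_htSp (h := h) v) hx.2
      rwa [zero_add] at this⟩) ⟨hx, hxn⟩
  rw [← hs]
  refine Finset.sum_eq_zero fun χ _ => ?_
  by_contra h0
  obtain ⟨c, -, -, -, rfl⟩ := G.exists_isTri_of_wtSp_ne_bot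
    ((Submodule.ne_bot_iff _).2 ⟨_, hf χ, h0⟩)
  set z := f (G.wt c)
  have hsum : ∑ i, c i = n := by
    have h2 := mem_htSp.1 (hfK (G.wt c)).2
    have h3 : ⁅(h : g), z⁆ = G.wt c h • z := hf (G.wt c) h
    rw [h3, wt_height h1] at h2
    exact_mod_cast smul_left_injective ℂ h0 h2
  obtain ⟨i, hi⟩ : ∃ i, 0 < c i := by
    by_contra! h2
    have := Finset.sum_nonpos fun i (_ : i ∈ Finset.univ) => h2 i
    omega
  have hc : ∀ i, 0 ≤ c i := by
    rcases G.nonneg_or_nonpos_of_wtSp_ne_bot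
      ((Submodule.ne_bot_iff _).2 ⟨_, hf (G.wt c), h0⟩) with h2 | h2
    · exact h2
    · exact absurd (h2 i) (by omega)
  have hT : casimirSum X Y n z = casimirCoeff G b c • z := by
    have hz : z ∈ Submodule.span ℂ {x | IsWord G.e c x} := by
      rw [← G.wtSp_wt_eq_span_isWord hi]
      exact hf _
    refine Submodule.span_induction
      (p := fun z _ => casimirSum X Y n z = casimirCoeff G b c • z) ?_ ?_ ?_ ?_ hz
    · intro w hw
      exact casimirSum_isWord hA h1 hsymm hb hε0 hd hw n le_rfl hsum
    · simp [casimirSum]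
    · intro u v _ _ hu hv
      rw [smul_add, ← hu, ← hv]
      simp [casimirSum, Finset.sum_add_distrib]
    · intro a u _ hu
      rw [smul_comm, ← hu]
      simp [casimirSum, Finset.smul_sum]
  rw [casimirSum_eq_zero hb hd hpos (hfK (G.wt c)).1 (hfK (G.wt c)).2] at hT
  have hC := (smul_eq_zero.1 hT.symm).resolve_right h0
  have hre := casimirCoeff_re_pos (G := G) hε hc ⟨i, hi⟩ fun s =>
    G.exists_nat_of_lie_f_eq_zero hA s (hf (G.wt c)) h0
      (hlief s _ (hfK (G.wt c)).1 (hfK (G.wt c)).2)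
  rw [hC] at hre
  simp at hre

theorem eq_zero_of_mem_ker_form (hA : IsGCM A) (h1 : ∀ i, G.root i h = 1)
    (hsymm : ∀ x y, b x y = b y x) (hb : ∀ x y z, b ⁅x, y⁆ z = b x ⁅y, z⁆)
    (hε : ∀ s, 0 < (b (G.e s) (G.f s)).re) (n : ℕ) : 1 ≤ n →
    (∀ x ∈ LinearMap.ker b, x ∈ G.htSp h n → x = 0) ∧
      ∀ x ∈ LinearMap.ker b, x ∈ G.htSp h (-n) → x = 0 := by
  induction n using Nat.strong_induction_on with
  | _ n ih =>
  intro hn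
  refine ⟨fun x hx hxn => ?_, fun x hx hxn => ?_⟩
  · exact eq_zero_of_mem_ker_form_of_lt hA h1 hsymm hb hε hn (fun k hk hkn => (ih k hkn hk).1)
      (fun k hk hkn => (ih k hkn hk).2) hx hxn
  · refine eq_zero_of_mem_ker_form_of_lt (G := G.opp) (h := (-h : G.H)) hA (opp_root_neg h1)
      hsymm hb (fun s => ?_) hn (fun k hk hkn y hy hyk => ?_) (fun k hk hkn y hy hyk => ?_) hx ?_
    · rw [hsymm]; exact hε s
    · exact (ih k hkn hk).2 y hy (by rwa [htSp_opp] at hyk)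
    · exact (ih k hkn hk).1 y hy (by rwa [htSp_opp, neg_neg] at hyk)
    · rwa [htSp_opp]

end KacMoodyAlgebra

end Radical

end KMG

namespace KMG

section Nondegenerate

variable {g : Type*} [LieRing g] [LieAlgebra ℂ g]
variable {I : Type*} [Fintype I] [DecidableEq I] {A : Matrix I I ℤ}

theorem rank_map_algebraMap_le {K L : Type*} [Field K] [Field L] [Algebra K L]
    (P : Matrix I I K) : (P.map (algebraMap K L)).rank ≤ P.rank := by
  let b : Module.Basis (Fin P.rank) K (LinearMap.range P.mulVecLin) := Module.finBasis K _
  let C : Matrix I (Fin P.rank) K := fun i k => (b k : I → K) i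
  let R : Matrix (Fin P.rank) I K := fun k j =>
    b.repr ⟨P.mulVecLin (Pi.single j 1), LinearMap.mem_range_self _ _⟩ k
  have hP : P = C * R := by
    ext i j
    have h := congrFun (congrArg Subtype.val
      (b.sum_repr ⟨P.mulVecLin (Pi.single j 1), LinearMap.mem_range_self _ _⟩)) i
    rw [AddSubmonoidClass.coe_finsetSum, Finset.sum_apply] at h
    rw [Matrix.mul_apply]
    refine Eq.trans ?_ (h.symm.trans (Finset.sum_congr rfl fun k _ => mul_comm _ _))
    simp
  have hmap : P.map (algebraMap K L) = C.map (algebraMap K L) * R.map (algebraMap K L) := by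
    conv_lhs => rw [hP, Matrix.map_mul]
  rw [hmap]
  exact (Matrix.rank_mul_le_left _ _).trans
    ((Matrix.rank_le_card_width _).trans (Fintype.card_fin _).le)

namespace KacMoodyAlgebra

variable (G : KacMoodyAlgebra A g)

theorem pi_root_surjective : Function.Surjective (LinearMap.pi G.root) := by
  rw [← LinearMap.dualMap_injective_iff, injective_iff_map_eq_zero]
  intro φ hφ
  have h1 : ∀ v : I → ℂ, φ v = ∑ i, φ (Pi.single i 1) * v i := by
    intro v
    conv_lhs => rw [← Finset.univ_sum_single v, map_sum]
    refine Finset.sum_congr rfl fun i _ => ?_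
    rw [mul_comm, ← smul_eq_mul, ← map_smul, ← Pi.single_smul, smul_eq_mul, mul_one]
  have h2 : ∑ i, φ (Pi.single i 1) • G.root i = 0 := by
    ext x
    have h3 := LinearMap.congr_fun hφ x
    rw [LinearMap.dualMap_apply, h1] at h3
    simpa [LinearMap.sum_apply] using h3
  have h4 := Fintype.linearIndependent_iff.1 G.indepRoot _ h2
  ext i
  simpa using h4 i

theorem exists_root_eq_one : ∃ h, ∀ i, G.root i h = 1 := by
  obtain ⟨h, hh⟩ := G.pi_root_surjective fun _ => 1
  exact ⟨h, fun i => congrFun hh i⟩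

theorem mem_span_coroot_of_root_eq_zero {x : G.H} (hx : ∀ i, G.root i x = 0) :
    ∃ a : I → ℂ, x = ∑ i, a i • G.coroot i := by
  have := G.findimH
  let P : Matrix I I ℂ := (A.map ((↑) : ℤ → ℚ)).map (algebraMap ℚ ℂ)
  let U : Submodule ℂ (I → ℂ) := LinearMap.ker P.transpose.mulVecLin
  let W : Submodule ℂ G.H := LinearMap.ker (LinearMap.pi G.root)
  have hr : P.rank ≤ (A.map ((↑) : ℤ → ℚ)).rank := rank_map_algebraMap_le _
  have hU : Module.finrank ℂ U + P.rank = Fintype.card I := by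
    have h1 := LinearMap.finrank_range_add_finrank_ker P.transpose.mulVecLin
    rw [Module.finrank_pi] at h1
    rw [← Matrix.rank_transpose P, ← h1, add_comm]
    rfl
  have hW : Module.finrank ℂ W = gcmCorank A := by
    have h1 := LinearMap.finrank_range_add_finrank_ker (LinearMap.pi G.root)
    rw [LinearMap.range_eq_top.2 G.pi_root_surjective, finrank_top, Module.finrank_pi,
      G.finrankH] at h1
    exact Nat.add_left_cancel h1
  let j : (I → ℂ) →ₗ[ℂ] G.H := Fintype.linearCombination ℂ G.coroot
  have hj : Function.Injective j :=
    linearIndependent_iff_injective_fintypeLinearCombination.1 G.indepCoroot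
  have hjU : U.map j ≤ W := by
    rintro _ ⟨a, ha, rfl⟩
    refine LinearMap.mem_ker.2 (funext fun t => ?_)
    have h1 := congrFun (LinearMap.mem_ker.1 ha) t
    rw [Matrix.mulVecLin_apply, Matrix.mulVec, dotProduct] at h1
    rw [LinearMap.pi_apply, Fintype.linearCombination_apply, map_sum, Pi.zero_apply]
    rw [Pi.zero_apply] at h1
    rw [← h1]
    refine Finset.sum_congr rfl fun s _ => ?_
    rw [map_smul, G.pairing, smul_eq_mul, mul_comm]
    simp [P]
  have hWU : U.map j = W := by
    refine Submodule.eq_of_le_of_finrank_le hjU ?_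
    rw [← (Submodule.equivMapOfInjective j hj U).finrank_eq, hW, gcmCorank]
    omega
  have hxW : x ∈ U.map j := hWU ▸ LinearMap.mem_ker.2 (funext hx)
  obtain ⟨a, -, ha⟩ := hxW
  exact ⟨a, ha.symm.trans (Fintype.linearCombination_apply ..)⟩

variable {G} {b : g →ₗ[ℂ] g →ₗ[ℂ] ℂ}

theorem eq_zero_of_mem_H_of_mem_ker_form (hsymm : ∀ x y, b x y = b y x)
    (hb : ∀ x y z, b ⁅x, y⁆ z = b x ⁅y, z⁆) (hε : ∀ s, b (G.e s) (G.f s) ≠ 0) {x : g}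
    (hx : x ∈ G.H) (hxb : x ∈ LinearMap.ker b) : x = 0 := by
  rw [LinearMap.mem_ker] at hxb
  have h1 : ∀ i, G.root i ⟨x, hx⟩ = 0 := by
    intro i
    have h2 := G.form_coroot hb i ⟨x, hx⟩
    rw [hsymm, hxb, LinearMap.zero_apply] at h2
    exact (mul_eq_zero.1 h2.symm).resolve_right (hε i)
  obtain ⟨a, ha⟩ := G.mem_span_coroot_of_root_eq_zero h1
  have h3 : ∑ i, (a i * b (G.e i) (G.f i)) • G.root i = 0 := by
    ext v
    have h4 : b x v = 0 := by rw [hxb, LinearMap.zero_apply]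
    have h5 : x = ∑ i, a i • (G.coroot i : g) := by
      have := congrArg Subtype.val ha
      simpa only [AddSubmonoidClass.coe_finsetSum, Submodule.coe_smul] using this
    rw [h5, map_sum, LinearMap.sum_apply] at h4
    rw [LinearMap.sum_apply, LinearMap.zero_apply, ← h4]
    refine Finset.sum_congr rfl fun i _ => ?_
    rw [map_smul, LinearMap.smul_apply, LinearMap.smul_apply, G.form_coroot hb, smul_eq_mul,
      smul_eq_mul]
    ring
  have h6 := Fintype.linearIndependent_iff.1 G.indepRoot _ h3
  have h7 : ∀ i, a i = 0 := fun i => (mul_eq_zero.1 (h6 i)).resolve_right (hε i)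
  have h8 : (⟨x, hx⟩ : G.H) = 0 := by
    rw [ha]
    exact Finset.sum_eq_zero fun i _ => by rw [h7, zero_smul]
  exact congrArg Subtype.val h8

/-- An invariant form of a Kac-Moody algebra for which the `(e s, f s)` have positive real part
is nondegenerate. -/
theorem ker_form_eq_bot (hA : IsGCM A) (hsymm : ∀ x y, b x y = b y x)
    (hb : ∀ x y z, b ⁅x, y⁆ z = b x ⁅y, z⁆) (hε : ∀ s, 0 < (b (G.e s) (G.f s)).re) :
    LinearMap.ker b = ⊥ := by
  obtain ⟨h, h1⟩ := G.exists_root_eq_one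
  refine (Submodule.eq_bot_iff _).2 fun x hx => ?_
  obtain ⟨f, hf, hs, hN⟩ := exists_wtSpace_decomp G.weight_decomp x
  have hfK := hN (LinearMap.ker b) (fun v x hx => lie_mem_ker_form hb _ hx) hx
  rw [← hs]
  refine Finset.sum_eq_zero fun χ _ => ?_
  by_contra h0
  obtain ⟨c, -, -, -, rfl⟩ := G.exists_isTri_of_wtSp_ne_bot
    ((Submodule.ne_bot_iff _).2 ⟨_, hf χ, h0⟩)
  have h2 : f (G.wt c) ∈ G.htSp h (∑ i, c i) := by
    rw [mem_htSp, ← wt_height h1]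
    exact hf _ h
  obtain ⟨n, hn⟩ := Int.eq_nat_or_neg (∑ i, c i)
  rcases Nat.eq_zero_or_pos n with rfl | hn0
  · have h3 : ∑ i, c i = 0 := by simpa using hn
    rw [h3] at h2
    refine h0 (eq_zero_of_mem_H_of_mem_ker_form hsymm hb (fun s h4 => ?_)
      (mem_H_of_mem_htSp_zero h1 h2) (hfK _))
    have := hε s
    rw [h4] at this
    simp at this
  · obtain ⟨h3, h4⟩ := eq_zero_of_mem_ker_form hA h1 hsymm hb hε n hn0
    rcases hn with hn | hn
    · exact h0 (h3 _ (hfK _) (hn ▸ h2))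
    · exact h0 (h4 _ (hfK _) (hn ▸ h2))

end KacMoodyAlgebra

end Nondegenerate

section Main

variable {I : Type*} [Fintype I] [DecidableEq I] {A : Matrix I I ℤ}
variable {g : Type*} [LieRing g] [LieAlgebra ℂ g]
variable {S : Type*} [Fintype S] [DecidableEq S] {B : Matrix S S ℤ}
variable {m : Type*} [LieRing m] [LieAlgebra ℂ m]

theorem symmetrizable_and_nondegenerate (hA : IsGCM A) (hB : IsGCM B) (G : KacMoodyAlgebra A g)
    (M : KacMoodyAlgebra B m) {φ : m →ₗ⁅ℂ⁆ g} (hgr : IsFinGrading M φ)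
    (hle : M.H.map φ.toLinearMap ≤ G.H) {Bf : g →ₗ[ℂ] g →ₗ[ℂ] ℂ} (hBf : NormalizedInvForm G Bf) :
    Symmetrizable B ∧ ∀ x : m, (∀ y : m, Bf (φ x) (φ y) = 0) → x = 0 := by
  obtain ⟨hsymm, hinv, -⟩ := hBf.1
  let b : m →ₗ[ℂ] m →ₗ[ℂ] ℂ := Bf.compl₁₂ φ.toLinearMap φ.toLinearMap
  have hbs : ∀ x y, b x y = b y x := fun x y => hsymm _ _
  have hbi : ∀ x y z, b ⁅x, y⁆ z = b x ⁅y, z⁆ := by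
    intro x y z
    change Bf (φ ⁅x, y⁆) (φ z) = Bf (φ x) (φ ⁅y, z⁆)
    rw [LieHom.map_lie, LieHom.map_lie, hinv]
  have hε : ∀ s, 0 < (b (M.e s) (M.f s)).re := re_form_pos hA hB G M hgr hle hBf
  refine ⟨symmetrizable_of_form M hbs hbi fun s h => ?_, fun x hx => ?_⟩
  · have := hε s
    rw [h] at this
    simp at this
  · have h : x ∈ LinearMap.ker b := LinearMap.mem_ker.2 (LinearMap.ext hx)
    rwa [KacMoodyAlgebra.ker_form_eq_bot hB hbs hbi hε, Submodule.mem_bot] at h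

end Main

end KMG

section Statement

attribute [local instance] Classical.propDecidable

variable {I : Type*} [Fintype I] [DecidableEq I] {A : Matrix I I ℤ}
variable {g : Type*} [LieRing g] [LieAlgebra ℂ g]
variable {S : Type*} [Fintype S] [DecidableEq S] {B : Matrix S S ℤ}
variable {m : Type*} [LieRing m] [LieAlgebra ℂ m]

theorem statement10
    (hGCM : IsGCM A) (hInd : Indecomposable A) (hSym : Symmetrizable A)
    (G : KacMoodyAlgebra A g)
    (hBgcm : IsGCM B) (hBind : Indecomposable B)
    (M : KacMoodyAlgebra B m) (φ : m →ₗ⁅ℂ⁆ g)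
    (hgr : IsFinGrading M φ) (hle : M.H.map φ.toLinearMap ≤ G.H)
    (Bf : g →ₗ[ℂ] g →ₗ[ℂ] ℂ) (hBf : NormalizedInvForm G Bf) :
    Symmetrizable B ∧ ∀ x : m, (∀ y : m, Bf (φ x) (φ y) = 0) → x = 0 := by
  exact symmetrizable_and_nondegenerate hGCM hBgcm G M hgr hle hBf

end Statement
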